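/- arXiv:2505.08976 — 3 statements merged into one kernel-verified Lean document; each statement's English description precedes it below -/
import Mathlib

section
/- The unit hypercube [0,1]⁴ ⊆ ℝ⁴ can be written as the union of three compact, connected subsets with pairwise disjoint, nonempty interiors, such that two of the subsets are homeomorphic (with their subspace topologies) to the closed unit ball in ℝ⁴, and the third is homeomorphic to (S¹ × S¹) × D², where S¹ = {v ∈ ℝ² : ‖v‖ = 1} and D² = {v ∈ ℝ² : ‖v‖ ≤ 1}. (Complement Covering Theorem at the hypercube with F a torus, recorded up to homeomorphism type of the pieces.) -/
open Set Metric

/-- The closed box in Euclidean space with opposite corners `a` and `b`. -/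
def euclideanBox {n : ℕ} (a b : Fin n → ℝ) : Set (EuclideanSpace ℝ (Fin n)) :=
  {x | ∀ k, x k ∈ Icc (a k) (b k)}

lemma isCompact_euclideanBox {n : ℕ} (a b : Fin n → ℝ) : IsCompact (euclideanBox a b) := by
  have h : IsCompact (Set.univ.pi fun k => Icc (a k) (b k)) :=
    isCompact_univ_pi fun k => isCompact_Icc
  have h' := (EuclideanSpace.equiv (Fin n) ℝ).toHomeomorph.isCompact_preimage.2 h
  convert h' using 1
  ext x
  exact (Set.mem_univ_pi (t := fun k => Icc (a k) (b k))).symm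

lemma convex_euclideanBox {n : ℕ} (a b : Fin n → ℝ) : Convex ℝ (euclideanBox a b) := by
  have h : euclideanBox a b = ⋂ k, {x | x k ∈ Icc (a k) (b k)} := by
    ext x
    simp [euclideanBox]
  rw [h]
  exact convex_iInter fun k =>
    (convex_Icc (a k) (b k)).is_linear_preimage ((EuclideanSpace.proj k).isLinear)

lemma mem_interior_euclideanBox {n : ℕ} {a b : Fin n → ℝ} {x : EuclideanSpace ℝ (Fin n)}
    (hx : ∀ k, x k ∈ Ioo (a k) (b k)) : x ∈ interior (euclideanBox a b) := by
  refine mem_interior.2 ⟨⋂ k, {y | y k ∈ Ioo (a k) (b k)}, ?_, ?_, by simpa using hx⟩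
  · intro y hy k
    exact Ioo_subset_Icc_self (mem_iInter.1 hy k)
  · exact isOpen_iInter_of_finite fun k =>
      isOpen_Ioo.preimage (EuclideanSpace.proj (𝕜 := ℝ) k).continuous

/-- The union of two convex bodies whose interiors share a point is a topological ball. -/
lemma nonempty_homeomorph_union_closedBall {E F : Type*}
    [NormedAddCommGroup E] [NormedSpace ℝ E] [FiniteDimensional ℝ E]
    [NormedAddCommGroup F] [NormedSpace ℝ F] [FiniteDimensional ℝ F]
    (hEF : Module.finrank ℝ E = Module.finrank ℝ F)
    {K L : Set E} (hK : Convex ℝ K) (hL : Convex ℝ L) (hKc : IsCompact K) (hLc : IsCompact L)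
    {c : E} (hcK : c ∈ interior K) (hcL : c ∈ interior L) :
    Nonempty (↥(K ∪ L) ≃ₜ closedBall (0 : F) 1) := by
  let e : E ≃L[ℝ] F := ContinuousLinearEquiv.ofFinrankEq hEF
  have key : ∀ M : Set E, Convex ℝ M → IsCompact M → c ∈ interior M →
      ∃ p : E → ℝ, Continuous p ∧ (∀ t : ℝ, 0 ≤ t → ∀ x, p (t • x) = t * p x) ∧
        (∀ x, x ≠ 0 → 0 < p x) ∧ ∀ x, x ∈ M ↔ p (x - c) ≤ 1 := by
    intro M hM hMc hc
    have hco : Convex ℝ ((fun x => x + c) ⁻¹' M) := hM.translate_preimage_left c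
    have h0 : (fun x => x + c) ⁻¹' M ∈ nhds (0 : E) := by
      apply (continuous_add_const c).continuousAt.preimage_mem_nhds
      simpa using mem_interior_iff_mem_nhds.1 hc
    have hcpt : IsCompact ((fun x => x + c) ⁻¹' M) :=
      (Homeomorph.addRight c).isCompact_preimage.2 hMc
    refine ⟨gauge ((fun x => x + c) ⁻¹' M), continuous_gauge hco h0,
      fun t ht x => by rw [gauge_smul_of_nonneg ht, smul_eq_mul], fun x hx => ?_, fun x => ?_⟩
    · exact (gauge_pos (absorbent_nhds_zero h0)
        ((NormedSpace.isVonNBounded_iff ℝ).2 hcpt.isBounded)).2 hx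
    · rw [gauge_le_one_iff_mem_closure hco h0, hcpt.isClosed.closure_eq]
      simp
  obtain ⟨p₁, hp₁c, hp₁h, hp₁p, hp₁m⟩ := key K hK hKc hcK
  obtain ⟨p₂, hp₂c, hp₂h, hp₂p, hp₂m⟩ := key L hL hLc hcL
  let p : E → ℝ := fun x => min (p₁ x) (p₂ x)
  have hpc : Continuous p := hp₁c.min hp₂c
  have hph : ∀ t : ℝ, 0 ≤ t → ∀ x, p (t • x) = t * p x := fun t ht x => by
    simp only [p, hp₁h t ht, hp₂h t ht, mul_min_of_nonneg _ _ ht]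
  have hpp : ∀ x, x ≠ 0 → 0 < p x := fun x hx => lt_min (hp₁p x hx) (hp₂p x hx)
  have hp0 : p 0 = 0 := by simpa using hph 0 le_rfl 0
  have hpm : ∀ x, x ∈ K ∪ L ↔ p (x - c) ≤ 1 := fun x => by
    rw [mem_union, hp₁m, hp₂m, min_le_iff]
  let f : E → F := fun x => (p x / ‖e x‖) • e x
  have hfn : ∀ x, ‖f x‖ = p x := by
    intro x
    rcases eq_or_ne x 0 with rfl | hx
    · simp [f, hp0]
    · have : ‖e x‖ ≠ 0 := by simpa using hx
      simp only [f, norm_smul, norm_div, norm_norm, Real.norm_of_nonneg (hpp x hx).le,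
        div_mul_cancel₀ _ this]
  have hfc : Continuous f := by
    refine continuous_iff_continuousAt.2 fun x => ?_
    rcases eq_or_ne x 0 with rfl | hx
    · have hf0 : f 0 = 0 := by simp [f]
      rw [ContinuousAt, hf0, tendsto_zero_iff_norm_tendsto_zero]
      simpa only [hfn, hp0] using hpc.tendsto 0
    · have : ‖e x‖ ≠ 0 := by simpa using hx
      exact ((hpc.continuousAt.div e.continuous.norm.continuousAt this)).smul
        e.continuous.continuousAt
  have hfi : Function.Injective f := by
    intro x y hxy
    have hp : p x = p y := by rw [← hfn, ← hfn, hxy]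
    rcases eq_or_ne x 0 with rfl | hx
    · by_contra hy
      have := hpp y (Ne.symm hy)
      rw [← hp, hp0] at this
      exact this.false
    · have hy : y ≠ 0 := by
        rintro rfl
        exact (hpp x hx).ne' (hp.trans hp0)
      have hex : 0 < ‖e x‖ := by simpa using hx
      have hey : 0 < ‖e y‖ := by simpa using hy
      have h1 : (p x / ‖e x‖) • x = (p y / ‖e y‖) • y := e.injective (by simpa [f] using hxy)
      have h2 := congrArg p h1
      rw [hph _ (div_pos (hpp x hx) hex).le, hph _ (div_pos (hpp y hy) hey).le, hp] at h2
      have h3 := mul_right_cancel₀ (hpp y hy).ne' h2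
      rw [hp, h3] at h1
      exact smul_right_injective E (div_pos (hpp y hy) hey).ne' h1
  have hfs : Function.Surjective f := by
    intro y
    rcases eq_or_ne y 0 with rfl | hy
    · exact ⟨0, by simp [f]⟩
    · have hx : e.symm y ≠ 0 := by simpa using hy
      have hy' : 0 < ‖y‖ := norm_pos_iff.2 hy
      have ht : 0 < ‖y‖ / p (e.symm y) := div_pos hy' (hpp _ hx)
      refine ⟨(‖y‖ / p (e.symm y)) • e.symm y, ?_⟩
      have := hpp _ hx
      simp only [f, hph _ ht.le, map_smul, ContinuousLinearEquiv.apply_symm_apply, norm_smul,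
        Real.norm_eq_abs, abs_of_pos ht, smul_smul]
      rw [show ‖y‖ / p (e.symm y) * p (e.symm y) / (‖y‖ / p (e.symm y) * ‖y‖) *
        (‖y‖ / p (e.symm y)) = 1 by field_simp, one_smul]
  have : CompactSpace ↥(K ∪ L) := isCompact_iff_compactSpace.1 (hKc.union hLc)
  let g : ↥(K ∪ L) → closedBall (0 : F) 1 := fun x =>
    ⟨f (x - c), by simpa [hfn] using (hpm x).1 x.2⟩
  have hg : Continuous g :=
    (hfc.comp (continuous_subtype_val.sub continuous_const)).subtype_mk _
  have hgb : Function.Bijective g := by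
    refine ⟨fun x y hxy => ?_, fun y => ?_⟩
    · exact Subtype.ext (sub_left_injective (hfi (congrArg Subtype.val hxy)))
    · obtain ⟨x, hx⟩ := hfs y
      refine ⟨⟨x + c, (hpm _).2 ?_⟩, Subtype.ext ?_⟩
      · rw [add_sub_cancel_right, ← hfn, hx]
        exact mem_closedBall_zero_iff.1 y.2
      · simpa [g] using hx
  exact ⟨Continuous.homeoOfEquivCompactToT2 (f := Equiv.ofBijective g hgb) hg⟩

/-- The region between two level sets of a positively homogeneous positive function is a
cylinder over the unit sphere. -/
lemma nonempty_homeomorph_shell {E : Type*} [NormedAddCommGroup E] [NormedSpace ℝ E]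
    {p : E → ℝ} (hpc : Continuous p) (hph : ∀ t : ℝ, 0 ≤ t → ∀ x, p (t • x) = t * p x)
    (hpp : ∀ x, x ≠ 0 → 0 < p x) {a b : ℝ} (ha : 0 < a) (c : E) :
    Nonempty ({x | p (x - c) ∈ Icc a b} ≃ₜ sphere (0 : E) 1 × Icc a b) := by
  have hp0 : p 0 = 0 := by simpa using hph 0 le_rfl 0
  have hne : ∀ x : {x | p (x - c) ∈ Icc a b}, (x : E) - c ≠ 0 := by
    intro x h
    have := x.2.1
    rw [h, hp0] at this
    exact this.not_gt ha
  have hsn : ∀ u : sphere (0 : E) 1, (u : E) ≠ 0 := fun u => ne_zero_of_mem_unit_sphere u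
  have hpu : ∀ (u : sphere (0 : E) 1) (r : Icc a b), p (((r : ℝ) / p u) • (u : E)) = r := by
    intro u r
    have := hpp u (hsn u)
    rw [hph _ (div_pos (ha.trans_le r.2.1) this).le]
    field_simp
  refine ⟨{
    toFun := fun x => (⟨‖(x : E) - c‖⁻¹ • ((x : E) - c), by
      simp [norm_smul, inv_mul_cancel₀ (norm_ne_zero_iff.2 (hne x))]⟩, ⟨p (x - c), x.2⟩)
    invFun := fun y => ⟨((y.2 : ℝ) / p y.1) • (y.1 : E) + c, by
      simp only [mem_ofPred_eq, add_sub_cancel_right, hpu, Subtype.coe_prop]⟩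
    left_inv := fun x => ?_
    right_inv := fun y => ?_
    continuous_toFun := ?_
    continuous_invFun := ?_ }⟩
  · have h1 := norm_ne_zero_iff.2 (hne x)
    have h2 := (hpp _ (hne x)).ne'
    apply Subtype.ext
    simp only [hph _ (inv_nonneg.2 (norm_nonneg _)), smul_smul]
    rw [show p (x - c) / (‖(x : E) - c‖⁻¹ * p (x - c)) * ‖(x : E) - c‖⁻¹ = 1 by field_simp,
      one_smul, sub_add_cancel]
  · obtain ⟨u, r⟩ := y
    have h1 : 0 < (r : ℝ) / p u := div_pos (ha.trans_le r.2.1) (hpp _ (hsn u))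
    have h2 : ‖(u : E)‖ = 1 := by simp
    refine Prod.ext (Subtype.ext ?_) (Subtype.ext ?_)
    · simp only [add_sub_cancel_right, norm_smul, h2, Real.norm_eq_abs, abs_of_pos h1, mul_one,
        smul_smul, inv_mul_cancel₀ h1.ne', one_smul]
    · simpa using hpu u r
  · refine Continuous.prodMk (Continuous.subtype_mk ?_ _) (Continuous.subtype_mk ?_ _)
    · exact Continuous.smul (Continuous.inv₀ (by fun_prop) fun x => norm_ne_zero_iff.2 (hne x))
        (by fun_prop)
    · exact hpc.comp (by fun_prop)
  · have h1 : Continuous fun y : sphere (0 : E) 1 × Icc a b => (y.1 : E) := by fun_prop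
    have h2 : Continuous fun y : sphere (0 : E) 1 × Icc a b => (y.2 : ℝ) / p y.1 :=
      Continuous.div (by fun_prop) (hpc.comp h1) fun y => (hpp _ (hsn y.1)).ne'
    exact ((h2.smul h1).add continuous_const).subtype_mk _

/-- Splitting the coordinates of `ℝ⁴` into the first two and the last two. -/
noncomputable def euclideanFourHomeomorph : EuclideanSpace ℝ (Fin 4) ≃ₜ
    EuclideanSpace ℝ (Fin 2) × EuclideanSpace ℝ (Fin 2) where
  toFun x := (!₂[x 0, x 1], !₂[x 2, x 3])
  invFun y := !₂[y.1 0, y.1 1, y.2 0, y.2 1]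
  left_inv x := by
    ext k
    fin_cases k <;> simp
  right_inv y := by
    refine Prod.ext ?_ ?_ <;> ext k <;> fin_cases k <;> simp
  continuous_toFun := by
    refine Continuous.prodMk ?_ ?_ <;>
      refine (PiLp.continuous_toLp 2 _).comp (continuous_pi fun k => ?_) <;>
      fin_cases k <;> simp <;> fun_prop
  continuous_invFun := by
    refine (PiLp.continuous_toLp 2 _).comp (continuous_pi fun k => ?_)
    fin_cases k <;> simp <;> fun_prop

/-- The closed square annulus in the unit square. -/
noncomputable def squareAnnulus : Set (EuclideanSpace ℝ (Fin 2)) :=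
  {x | max |(x - !₂[(1/2 : ℝ), 1/2]) 0| |(x - !₂[(1/2 : ℝ), 1/2]) 1| ∈ Icc (1/4 : ℝ) (1/2)}

lemma nonempty_homeomorph_squareAnnulus : Nonempty (squareAnnulus ≃ₜ
    sphere (0 : EuclideanSpace ℝ (Fin 2)) 1 × Icc (1/4 : ℝ) (1/2)) := by
  refine nonempty_homeomorph_shell (p := fun x : EuclideanSpace ℝ (Fin 2) => max |x 0| |x 1|)
    (by fun_prop) (fun t ht x => ?_) (fun x hx => ?_) (by norm_num) _
  · simp [abs_mul, abs_of_nonneg ht, mul_max_of_nonneg _ _ ht]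
  · by_contra! h
    refine hx ?_
    ext k
    have h0 := abs_nonpos_iff.1 ((le_max_left _ _).trans h)
    have h1 := abs_nonpos_iff.1 ((le_max_right _ _).trans h)
    fin_cases k <;> simp [h0, h1]

/-- The product of two square annuli, as a subset of the hypercube. -/
noncomputable def thickTorus : Set (EuclideanSpace ℝ (Fin 4)) :=
  euclideanFourHomeomorph ⁻¹' squareAnnulus ×ˢ squareAnnulus

lemma mem_thickTorus {x : EuclideanSpace ℝ (Fin 4)} : x ∈ thickTorus ↔
    (max |x 0 - 1/2| |x 1 - 1/2| ∈ Icc (1/4 : ℝ) (1/2)) ∧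
      max |x 2 - 1/2| |x 3 - 1/2| ∈ Icc (1/4 : ℝ) (1/2) := by
  simp [thickTorus, squareAnnulus, euclideanFourHomeomorph]

lemma nonempty_homeomorph_thickTorus : Nonempty (thickTorus ≃ₜ
    (sphere (0 : EuclideanSpace ℝ (Fin 2)) 1 × sphere (0 : EuclideanSpace ℝ (Fin 2)) 1) ×
      closedBall (0 : EuclideanSpace ℝ (Fin 2)) 1) := by
  obtain ⟨f⟩ := nonempty_homeomorph_squareAnnulus
  have hI : (3/8 : ℝ) ∈ Ioo (1/4 : ℝ) (1/2) := by norm_num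
  have hc : ((3/8, 3/8) : ℝ × ℝ) ∈ interior (Icc (1/4 : ℝ) (1/2) ×ˢ Icc (1/4 : ℝ) (1/2)) := by
    rw [interior_prod_eq, interior_Icc]
    exact ⟨hI, hI⟩
  have hconv : Convex ℝ (Icc (1/4 : ℝ) (1/2) ×ˢ Icc (1/4 : ℝ) (1/2)) :=
    (convex_Icc _ _).prod (convex_Icc _ _)
  have hcpt := (isCompact_Icc (a := (1/4 : ℝ)) (b := (1/2 : ℝ))).prod
    (isCompact_Icc (a := (1/4 : ℝ)) (b := (1/2 : ℝ)))
  obtain ⟨g⟩ := nonempty_homeomorph_union_closedBall (F := EuclideanSpace ℝ (Fin 2)) (by simp)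
    hconv hconv hcpt hcpt hc hc
  rw [union_self] at g
  exact ⟨(euclideanFourHomeomorph.subtype fun _ => Iff.rfl).trans <|
    (Homeomorph.Set.prod _ _).trans <| (f.prodCongr f).trans <|
    (Homeomorph.prodProdProdComm _ _ _ _).trans <|
    (Homeomorph.refl _).prodCongr ((Homeomorph.Set.prod _ _).symm.trans g)⟩

/-- The union of two boxes whose interiors share a point is a topological ball. -/
lemma nonempty_homeomorph_box_union {n : ℕ} {a b a' b' c : Fin n → ℝ}
    (h : ∀ k, c k ∈ Ioo (a k) (b k)) (h' : ∀ k, c k ∈ Ioo (a' k) (b' k)) :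
    Nonempty (↥(euclideanBox a b ∪ euclideanBox a' b') ≃ₜ
      closedBall (0 : EuclideanSpace ℝ (Fin n)) 1) :=
  nonempty_homeomorph_union_closedBall rfl (convex_euclideanBox a b) (convex_euclideanBox a' b')
    (isCompact_euclideanBox a b) (isCompact_euclideanBox a' b')
    (mem_interior_euclideanBox (x := WithLp.toLp 2 c) h) (mem_interior_euclideanBox h')

/-- A set all of whose points have a coordinate in a fixed countable set has empty interior. -/
lemma interior_eq_empty_of_coord_mem_countable {n : ℕ} {S : Set ℝ} (hS : S.Countable)
    {A : Set (EuclideanSpace ℝ (Fin n))} (hA : ∀ x ∈ A, ∃ k, x k ∈ S) : interior A = ∅ := by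
  have hd : Dense (Set.univ.pi fun _ : Fin n => Sᶜ) :=
    dense_pi _ fun _ _ => hS.dense_compl ℝ
  have hd' := hd.preimage (EuclideanSpace.equiv (Fin n) ℝ).toHomeomorph.isOpenMap
  rw [interior_eq_empty_iff_dense_compl]
  refine hd'.mono fun x hx hxA => ?_
  obtain ⟨k, hk⟩ := hA x hxA
  exact hx k (mem_univ k) hk

lemma CompactSpace.isCompact_of_homeomorph {X Y : Type*} [TopologicalSpace X] [TopologicalSpace Y]
    [CompactSpace Y] {A : Set X} (e : A ≃ₜ Y) : IsCompact A :=
  isCompact_iff_compactSpace.2 e.symm.compactSpace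

lemma ConnectedSpace.isConnected_of_homeomorph {X Y : Type*} [TopologicalSpace X]
    [TopologicalSpace Y] [ConnectedSpace Y] {A : Set X} (e : A ≃ₜ Y) : IsConnected A :=
  isConnected_iff_connectedSpace.2 (e.symm.surjective.connectedSpace e.symm.continuous)


/-- **Complement Covering Theorem for the hypercube (torus case).** The unit hypercube
`[0,1]⁴ ⊆ ℝ⁴` is the union of three compact connected subsets with pairwise disjoint
nonempty interiors, two of which are homeomorphic to the closed unit 4-ball and the
third to `(S¹ × S¹) × D²`. -/
theorem hypercube4_three_piece_decomposition_torus :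
    ∃ T : Fin 3 → Set (EuclideanSpace ℝ (Fin 4)),
      (⋃ i, T i) = {x : EuclideanSpace ℝ (Fin 4) | ∀ k, x k ∈ Set.Icc (0 : ℝ) 1} ∧
      (∀ i, IsCompact (T i)) ∧
      (∀ i, IsConnected (T i)) ∧
      (∀ i, (interior (T i)).Nonempty) ∧
      (∀ i j, i ≠ j → interior (T i) ∩ interior (T j) = ∅) ∧
      Nonempty ((T 0) ≃ₜ Metric.closedBall (0 : EuclideanSpace ℝ (Fin 4)) 1) ∧
      Nonempty ((T 1) ≃ₜ Metric.closedBall (0 : EuclideanSpace ℝ (Fin 4)) 1) ∧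
      Nonempty ((T 2) ≃ₜ
        ((Metric.sphere (0 : EuclideanSpace ℝ (Fin 2)) 1 ×
          Metric.sphere (0 : EuclideanSpace ℝ (Fin 2)) 1) ×
          Metric.closedBall (0 : EuclideanSpace ℝ (Fin 2)) 1)) := by
  let B₀ := euclideanBox ![1/4, 1/4, 0, 0] ![1/2, 3/4, 1, 1] ∪
    euclideanBox ![0, 0, 1/4, 1/4] ![1/2, 1, 3/4, 3/4]
  let B₁ := euclideanBox ![1/2, 1/4, 0, 0] ![3/4, 3/4, 1, 1] ∪
    euclideanBox ![1/2, 0, 1/4, 1/4] ![1, 1, 3/4, 3/4]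
  have h₀ : Nonempty (B₀ ≃ₜ closedBall (0 : EuclideanSpace ℝ (Fin 4)) 1) := by
    refine nonempty_homeomorph_box_union (c := ![3/8, 1/2, 1/2, 1/2]) ?_ ?_ <;>
      simp [Fin.forall_fin_succ] <;> norm_num
  have h₁ : Nonempty (B₁ ≃ₜ closedBall (0 : EuclideanSpace ℝ (Fin 4)) 1) := by
    refine nonempty_homeomorph_box_union (c := ![5/8, 1/2, 1/2, 1/2]) ?_ ?_ <;>
      simp [Fin.forall_fin_succ] <;> norm_num
  have h₂ := nonempty_homeomorph_thickTorus
  have m₀ : ∀ x, x ∈ B₀ ↔ ((1/4 ≤ x 0 ∧ x 0 ≤ 1/2) ∧ (1/4 ≤ x 1 ∧ x 1 ≤ 3/4) ∧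
      (0 ≤ x 2 ∧ x 2 ≤ 1) ∧ (0 ≤ x 3 ∧ x 3 ≤ 1)) ∨ ((0 ≤ x 0 ∧ x 0 ≤ 1/2) ∧
      (0 ≤ x 1 ∧ x 1 ≤ 1) ∧ (1/4 ≤ x 2 ∧ x 2 ≤ 3/4) ∧ (1/4 ≤ x 3 ∧ x 3 ≤ 3/4)) := by
    intro x
    simp [B₀, euclideanBox, Fin.forall_fin_succ]
  have m₁ : ∀ x, x ∈ B₁ ↔ ((1/2 ≤ x 0 ∧ x 0 ≤ 3/4) ∧ (1/4 ≤ x 1 ∧ x 1 ≤ 3/4) ∧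
      (0 ≤ x 2 ∧ x 2 ≤ 1) ∧ (0 ≤ x 3 ∧ x 3 ≤ 1)) ∨ ((1/2 ≤ x 0 ∧ x 0 ≤ 1) ∧
      (0 ≤ x 1 ∧ x 1 ≤ 1) ∧ (1/4 ≤ x 2 ∧ x 2 ≤ 3/4) ∧ (1/4 ≤ x 3 ∧ x 3 ≤ 3/4)) := by
    intro x
    simp [B₁, euclideanBox, Fin.forall_fin_succ]
  have m₂ : ∀ x, x ∈ thickTorus ↔ (((x 0 ≤ 1/4 ∨ 3/4 ≤ x 0) ∨ (x 1 ≤ 1/4 ∨ 3/4 ≤ x 1)) ∧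
      ((x 2 ≤ 1/4 ∨ 3/4 ≤ x 2) ∨ (x 3 ≤ 1/4 ∨ 3/4 ≤ x 3))) ∧
      (0 ≤ x 0 ∧ x 0 ≤ 1) ∧ (0 ≤ x 1 ∧ x 1 ≤ 1) ∧ (0 ≤ x 2 ∧ x 2 ≤ 1) ∧
      (0 ≤ x 3 ∧ x 3 ≤ 1) := by
    intro x
    have lo : ∀ t : ℝ, 1/4 ≤ |t - 1/2| ↔ t ≤ 1/4 ∨ 3/4 ≤ t := fun t => by grind
    have hi : ∀ t : ℝ, |t - 1/2| ≤ 1/2 ↔ 0 ≤ t ∧ t ≤ 1 := fun t => by grind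
    simp only [mem_thickTorus, mem_Icc, le_max_iff, max_le_iff, lo, hi]
    tauto
  have hS : ({1/4, 1/2, 3/4} : Set ℝ).Countable := (Set.toFinite _).countable
  have disj : ∀ A A' : Set (EuclideanSpace ℝ (Fin 4)),
      (∀ x, x ∈ A → x ∈ A' → ∃ k, x k ∈ ({1/4, 1/2, 3/4} : Set ℝ)) →
      interior A ∩ interior A' = ∅ := fun A A' h => by
    rw [← interior_inter]
    exact interior_eq_empty_of_coord_mem_countable hS fun x hx => h x hx.1 hx.2
  have d₀₁ : interior B₀ ∩ interior B₁ = ∅ := disj _ _ fun x h h' => by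
    rw [m₀] at h
    rw [m₁] at h'
    exact ⟨0, by simp only [mem_insert_iff, mem_singleton_iff]; grind⟩
  have d₀₂ : interior B₀ ∩ interior thickTorus = ∅ := disj _ _ fun x h h' => by
    rw [m₀] at h
    rw [m₂] at h'
    simp only [mem_insert_iff, mem_singleton_iff, Fin.exists_fin_succ]
    grind
  have d₁₂ : interior B₁ ∩ interior thickTorus = ∅ := disj _ _ fun x h h' => by
    rw [m₁] at h
    rw [m₂] at h'
    simp only [mem_insert_iff, mem_singleton_iff, Fin.exists_fin_succ]
    grind
  have i₀ : (interior B₀).Nonempty := ⟨!₂[3/8, 1/2, 1/2, 1/2], interior_mono subset_union_left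
    (mem_interior_euclideanBox (by simp [Fin.forall_fin_succ]; norm_num))⟩
  have i₁ : (interior B₁).Nonempty := ⟨!₂[5/8, 1/2, 1/2, 1/2], interior_mono subset_union_left
    (mem_interior_euclideanBox (by simp [Fin.forall_fin_succ]; norm_num))⟩
  have i₂ : (interior thickTorus).Nonempty := by
    have hsub : euclideanBox ![0, 0, 0, 0] ![1/4, 1/4, 1/4, 1/4] ⊆ thickTorus := by
      intro x hx
      simp only [euclideanBox, Fin.forall_fin_succ] at hx
      simp at hx
      rw [m₂]
      grind
    exact ⟨!₂[1/8, 1/8, 1/8, 1/8], interior_mono hsub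
      (mem_interior_euclideanBox (by simp [Fin.forall_fin_succ]; norm_num))⟩
  have : ConnectedSpace (closedBall (0 : EuclideanSpace ℝ (Fin 4)) 1) :=
    isConnected_iff_connectedSpace.1 ((convex_closedBall _ _).isConnected ⟨0, by simp⟩)
  have : ConnectedSpace (closedBall (0 : EuclideanSpace ℝ (Fin 2)) 1) :=
    isConnected_iff_connectedSpace.1 ((convex_closedBall _ _).isConnected ⟨0, by simp⟩)
  have : ConnectedSpace (sphere (0 : EuclideanSpace ℝ (Fin 2)) 1) :=
    isConnected_iff_connectedSpace.1 (isConnected_sphere (by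
      rw [← Module.finrank_eq_rank]; simp) _ zero_le_one)
  refine ⟨![B₀, B₁, thickTorus], ?_, ?_, ?_, ?_, ?_, h₀, h₁, h₂⟩
  · ext x
    simp only [mem_iUnion, Fin.exists_fin_succ, mem_ofPred_eq, Fin.forall_fin_succ, mem_Icc]
    simp [m₀, m₁, m₂]
    grind
  · simp only [Fin.forall_fin_succ]
    simpa using ⟨CompactSpace.isCompact_of_homeomorph h₀.some,
      CompactSpace.isCompact_of_homeomorph h₁.some, CompactSpace.isCompact_of_homeomorph h₂.some⟩
  · simp only [Fin.forall_fin_succ]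
    simpa using ⟨ConnectedSpace.isConnected_of_homeomorph h₀.some,
      ConnectedSpace.isConnected_of_homeomorph h₁.some,
      ConnectedSpace.isConnected_of_homeomorph h₂.some⟩
  · simp only [Fin.forall_fin_succ]
    simpa using ⟨i₀, i₁, i₂⟩
  · clear_value B₀ B₁
    simp [Fin.forall_fin_succ, d₀₁, d₀₂, d₁₂, inter_comm (interior B₁) (interior B₀),
      inter_comm (interior thickTorus)]
end

section
/- For every integer k ≥ 2, the closed unit ball B⁴ = {x ∈ ℝ⁴ : ‖x‖ ≤ 1} can be written as the union of k + 1 compact, connected subsets with pairwise disjoint, nonempty interiors, such that k of the subsets are homeomorphic (with their subspace topologies) to the closed unit ball in ℝ⁴, and the remaining one is homeomorphic to S² × D², where S² = {v ∈ ℝ³ : ‖v‖ = 1} and D² = {v ∈ ℝ² : ‖v‖ ≤ 1}. (This is Step 1 of the paper's pinwheel construction: decomposing the 4-ball into one 'interesting' piece and n − 1 smaller 4-balls, recorded up to homeomorphism type in the case where F is a 2-sphere.) -/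
open Set Metric

/-- A compact convex set with nonempty interior is carried onto the closed unit ball of any
normed space of the same finite dimension by a homeomorphism of the ambient spaces. -/
theorem exists_homeomorph_image_eq_closedBall {E F : Type*}
    [NormedAddCommGroup E] [NormedSpace ℝ E] [FiniteDimensional ℝ E]
    [NormedAddCommGroup F] [NormedSpace ℝ F] [FiniteDimensional ℝ F]
    (hEF : Module.finrank ℝ E = Module.finrank ℝ F) {s : Set E} (hs : Convex ℝ s)
    (hc : IsCompact s) (hi : (interior s).Nonempty) :
    ∃ h : E ≃ₜ F, h '' s = closedBall (0 : F) 1 := by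
  let L : E ≃L[ℝ] F := ContinuousLinearEquiv.ofFinrankEq hEF
  have hLc : IsCompact (L '' s) := hc.image L.continuous
  have hLi : (interior (L '' s)).Nonempty := by
    have := L.toHomeomorph.image_interior s
    rw [ContinuousLinearEquiv.coe_toHomeomorph] at this
    rw [← this]
    exact hi.image L
  obtain ⟨e, -, he, -⟩ := exists_homeomorph_image_interior_closure_frontier_eq_unitBall
    (hs.linear_image L.toLinearEquiv.toLinearMap) hLi hLc.isBounded
  refine ⟨L.toHomeomorph.trans e, ?_⟩
  rw [← he]
  exact (image_comp e L s).trans (congrArg (e '' ·) hLc.isClosed.closure_eq.symm)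

/-- Polar coordinates on the part of `V × ℝ` cut out by a condition on `(‖v‖, t)` which
forces `0 < ‖v‖`. -/
noncomputable def polarHomeomorph {V : Type*} [NormedAddCommGroup V] [NormedSpace ℝ V]
    (R : Set (ℝ × ℝ)) (hR : ∀ q ∈ R, 0 < q.1) :
    {p : V × ℝ | (‖p.1‖, p.2) ∈ R} ≃ₜ sphere (0 : V) 1 × R where
  toFun p := (⟨‖p.1.1‖⁻¹ • p.1.1, by
    have := hR _ p.2
    simp [norm_smul, this.ne']⟩, ⟨(‖p.1.1‖, p.1.2), p.2⟩)
  invFun q := ⟨(q.2.1.1 • q.1.1, q.2.1.2), by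
    have h := hR _ q.2.2
    have h1 : ‖q.1.1‖ = 1 := by simp
    simp [norm_smul, abs_of_pos h]⟩
  left_inv p := by
    have h := hR _ p.2
    ext1
    exact Prod.ext (smul_inv_smul₀ h.ne' _) rfl
  right_inv q := by
    have h := hR _ q.2.2
    have h2 : ‖q.2.1.1 • q.1.1‖ = q.2.1.1 := by simp [norm_smul, abs_of_pos h]
    refine Prod.ext (Subtype.ext ?_) (Subtype.ext (Prod.ext h2 rfl))
    change ‖q.2.1.1 • q.1.1‖⁻¹ • q.2.1.1 • q.1.1 = q.1.1
    rw [h2, inv_smul_smul₀ h.ne']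
  continuous_toFun := by
    have hn : Continuous fun p : {p : V × ℝ | (‖p.1‖, p.2) ∈ R} ↦ ‖p.1.1‖⁻¹ :=
      Continuous.inv₀ (by fun_prop) fun p ↦ (hR _ p.2).ne'
    fun_prop
  continuous_invFun := by fun_prop


/-- **Pinwheel construction, Step 1 (sphere case).** For every `k ≥ 2`, the closed unit
ball `B⁴ ⊆ ℝ⁴` is the union of `k + 1` compact connected subsets with pairwise disjoint
nonempty interiors, `k` of which are homeomorphic to the closed unit 4-ball and the
remaining one to `S² × D²`. -/
theorem unitBall4_k_balls_plus_sphere_piece (k : ℕ) (hk : 2 ≤ k) :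
    ∃ T : Fin (k + 1) → Set (EuclideanSpace ℝ (Fin 4)),
      (⋃ i, T i) = Metric.closedBall (0 : EuclideanSpace ℝ (Fin 4)) 1 ∧
      (∀ i, IsCompact (T i)) ∧
      (∀ i, IsConnected (T i)) ∧
      (∀ i, (interior (T i)).Nonempty) ∧
      (∀ i j, i ≠ j → interior (T i) ∩ interior (T j) = ∅) ∧
      (∀ i : Fin (k + 1), (i : ℕ) < k →
        Nonempty ((T i) ≃ₜ Metric.closedBall (0 : EuclideanSpace ℝ (Fin 4)) 1)) ∧
      Nonempty ((T ⟨k, Nat.lt_succ_self k⟩) ≃ₜ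
        (Metric.sphere (0 : EuclideanSpace ℝ (Fin 3)) 1 ×
          Metric.closedBall (0 : EuclideanSpace ℝ (Fin 2)) 1)) := by
  let V := EuclideanSpace ℝ (Fin 3)
  have hk0 : (0 : ℝ) < k := by exact_mod_cast (by omega : 0 < k)
  have hVR : Module.finrank ℝ (V × ℝ) =
      Module.finrank ℝ (EuclideanSpace ℝ (Fin 4)) := by simp [V]
  have cyl (r a b : ℝ) (hr : 0 < r) (hab : a < b) :
      Convex ℝ (closedBall (0 : V) r ×ˢ Icc a b) ∧
      IsCompact (closedBall (0 : V) r ×ˢ Icc a b) ∧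
      (interior (closedBall (0 : V) r ×ˢ Icc a b)).Nonempty := by
    refine ⟨(convex_closedBall _ _).prod (convex_Icc _ _),
      (isCompact_closedBall _ _).prod isCompact_Icc, ?_⟩
    rw [interior_prod_eq, interior_Icc]
    exact .prod ⟨0, ball_subset_interior_closedBall (mem_ball_self hr)⟩ (nonempty_Ioo.2 hab)
  obtain ⟨cylConv, cylComp, cylInt⟩ := cyl 2 0 k two_pos hk0
  obtain ⟨h, hh⟩ := exists_homeomorph_image_eq_closedBall hVR cylConv cylComp cylInt
  let R : Set (ℝ × ℝ) := Icc 1 2 ×ˢ Icc 0 (k : ℝ)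
  let S : Set (V × ℝ) := {p | (‖p.1‖, p.2) ∈ R}
  have hRS : Nonempty (S ≃ₜ sphere (0 : V) 1 ×
      closedBall (0 : EuclideanSpace ℝ (Fin 2)) 1) := by
    have hRi : (interior R).Nonempty := by
      rw [interior_prod_eq, interior_Icc, interior_Icc]
      exact .prod (nonempty_Ioo.2 one_lt_two) (nonempty_Ioo.2 hk0)
    obtain ⟨g, hg⟩ := exists_homeomorph_image_eq_closedBall
      (F := EuclideanSpace ℝ (Fin 2)) (by simp)
      ((convex_Icc (1 : ℝ) 2).prod (convex_Icc (0 : ℝ) k))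
      (isCompact_Icc.prod isCompact_Icc) hRi
    exact ⟨(polarHomeomorph R fun q hq ↦ one_pos.trans_le hq.1.1).trans
      ((Homeomorph.refl _).prodCongr ((g.image R).trans (.setCongr hg)))⟩
  have hSc : IsCompact S := by
    refine cylComp.of_isClosed_subset ?_ ?_
    · exact (isClosed_Icc.prod isClosed_Icc).preimage (by fun_prop)
    · exact fun p hp ↦ ⟨mem_closedBall_zero_iff.2 hp.1.2, hp.2⟩
  have hSconn : IsConnected S := by
    obtain ⟨f⟩ := hRS
    have : ConnectedSpace (sphere (0 : V) 1) := isConnected_iff_connectedSpace.1 <|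
      isConnected_sphere (by rw [← Module.finrank_eq_rank]; simp [V]) _ zero_le_one
    have : ConnectedSpace (closedBall (0 : EuclideanSpace ℝ (Fin 2)) 1) :=
      isConnected_iff_connectedSpace.1 <|
        (convex_closedBall _ _).isConnected ⟨0, mem_closedBall_self zero_le_one⟩
    exact isConnected_iff_connectedSpace.2 (f.symm.surjective.connectedSpace f.symm.continuous)
  have hSi : (interior S).Nonempty := by
    obtain ⟨v, hv⟩ : ∃ v : V, ‖v‖ = 3 / 2 := exists_norm_eq V (by norm_num)
    refine ⟨(v, k / 2), ?_⟩
    rw [mem_interior]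
    refine ⟨(fun p : V × ℝ ↦ (‖p.1‖, p.2)) ⁻¹' (Ioo 1 2 ×ˢ Ioo 0 (k : ℝ)),
      preimage_mono (prod_mono Ioo_subset_Icc_self Ioo_subset_Icc_self),
      (isOpen_Ioo.prod isOpen_Ioo).preimage (by fun_prop), ?_⟩
    simp only [mem_preimage, mem_prod, mem_Ioo, hv]
    refine ⟨?_, ?_⟩ <;> constructor <;> linarith
  let P (i : Fin (k + 1)) : Set (V × ℝ) :=
    if (i : ℕ) < k then closedBall 0 1 ×ˢ Icc ((i : ℕ) : ℝ) ((i : ℕ) + 1) else S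
  have hP (i : Fin (k + 1)) (hi : (i : ℕ) < k) :
      P i = closedBall 0 1 ×ˢ Icc ((i : ℕ) : ℝ) ((i : ℕ) + 1) := if_pos hi
  have hPS (i : Fin (k + 1)) (hi : ¬ (i : ℕ) < k) : P i = S := if_neg hi
  have hcyl (i : Fin (k + 1)) := cyl 1 ((i : ℕ) : ℝ) ((i : ℕ) + 1) one_pos (lt_add_one _)
  have hcomp (i) : IsCompact (P i) := by
    by_cases hi : (i : ℕ) < k
    · rw [hP i hi]; exact (hcyl i).2.1
    · rwa [hPS i hi]
  have hint (i) : (interior (P i)).Nonempty := by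
    by_cases hi : (i : ℕ) < k
    · rw [hP i hi]; exact (hcyl i).2.2
    · rwa [hPS i hi]
  have hconn (i) : IsConnected (P i) := by
    by_cases hi : (i : ℕ) < k
    · rw [hP i hi]; exact (hcyl i).1.isConnected ((hcyl i).2.2.mono interior_subset)
    · rwa [hPS i hi]
  have hdisj (i j : Fin (k + 1)) (hij : i < j) : Disjoint (interior (P i)) (interior (P j)) := by
    have hi : (i : ℕ) < k := by omega
    rw [hP i hi, interior_prod_eq, interior_Icc, interior_closedBall _ one_ne_zero,
      Set.disjoint_left]
    rintro p ⟨hp1, hp2⟩ hpj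
    by_cases hj : (j : ℕ) < k
    · rw [hP j hj, interior_prod_eq, interior_Icc] at hpj
      have : ((i : ℕ) : ℝ) + 1 ≤ (j : ℕ) := by exact_mod_cast hij
      linarith [hp2.2, hpj.2.1]
    · rw [hPS j hj] at hpj
      exact (mem_ball_zero_iff.1 hp1).not_ge (interior_subset hpj).1.1
  have hunion : ⋃ i, P i = closedBall (0 : V) 2 ×ˢ Icc (0 : ℝ) k := by
    ext ⟨v, t⟩
    simp only [mem_iUnion, mem_prod, mem_closedBall_zero_iff, mem_Icc]
    constructor
    · rintro ⟨i, hi⟩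
      by_cases hik : (i : ℕ) < k
      · rw [hP i hik] at hi
        obtain ⟨h1, h2, h3⟩ := hi
        rw [mem_closedBall_zero_iff] at h1
        have : ((i : ℕ) : ℝ) + 1 ≤ k := by exact_mod_cast hik
        have : (0 : ℝ) ≤ (i : ℕ) := Nat.cast_nonneg _
        dsimp only at h1 h2 h3
        exact ⟨by linarith, by linarith, by linarith⟩
      · rw [hPS i hik] at hi
        exact ⟨hi.1.2, hi.2⟩
    · rintro ⟨hv, ht0, htk⟩
      rcases le_total 1 ‖v‖ with h1 | h1
      · exact ⟨Fin.last k, by rw [hPS _ (by simp)]; exact ⟨⟨h1, hv⟩, ht0, htk⟩⟩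
      · obtain ⟨n, hn, hnt, htn⟩ : ∃ n < k, (n : ℝ) ≤ t ∧ t ≤ n + 1 := by
          rcases htk.lt_or_eq with htk | rfl
          · exact ⟨⌊t⌋₊, (Nat.floor_lt ht0).2 htk, Nat.floor_le ht0, (Nat.lt_floor_add_one t).le⟩
          · exact ⟨k - 1, by omega, by exact_mod_cast Nat.sub_le k 1,
              by exact_mod_cast (by omega : k ≤ k - 1 + 1)⟩
        refine ⟨⟨n, by omega⟩, ?_⟩
        rw [hP _ hn]
        exact ⟨mem_closedBall_zero_iff.2 h1, hnt, htn⟩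
  refine ⟨fun i ↦ h '' P i, ?_, fun i ↦ (hcomp i).image h.continuous,
    fun i ↦ (hconn i).image h h.continuous.continuousOn, fun i ↦ ?_, fun i j hij ↦ ?_,
    fun i hi ↦ ?_, ?_⟩
  · rw [← image_iUnion, hunion, hh]
  · rw [← h.image_interior]
    exact (hint i).image h
  · rw [← h.image_interior, ← h.image_interior, ← image_inter h.injective, image_eq_empty,
      ← disjoint_iff_inter_eq_empty]
    rcases lt_or_gt_of_ne hij with hij | hij
    · exact hdisj i j hij
    · exact (hdisj j i hij).symm
  · obtain ⟨g, hg⟩ := exists_homeomorph_image_eq_closedBall hVR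
      (hcyl i).1 (hcyl i).2.1 (hcyl i).2.2
    rw [← hP i hi] at hg
    exact ⟨(h.image (P i)).symm.trans ((g.image (P i)).trans (.setCongr hg))⟩
  · obtain ⟨f⟩ := hRS
    exact ⟨(h.image _).symm.trans ((Homeomorph.setCongr (hPS _ (lt_irrefl k))).trans f)⟩
end

section
/- For every integer n ≥ 3, the closed unit ball B³ = {x ∈ ℝ³ : ‖x‖ ≤ 1} admits a monohedral tiling by n tiles, each of which is homeomorphic (with its subspace topology) to the solid torus S¹ × D², where S¹ = {v ∈ ℝ² : ‖v‖ = 1} is the unit circle and D² = {v ∈ ℝ² : ‖v‖ ≤ 1} is the closed unit disk. (This records, up to homeomorphism type of the tiles, the paper's Corollary 3.2 / Oh's theorem that the 3-ball can be tiled by n congruent neighborhoods of any knot.) -/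
open Set Metric Topology

/-- A continuous map that is injective on a compact set is a homeomorphism onto its image. -/
theorem IsCompact.nonempty_homeomorph_image {A B : Type*} [TopologicalSpace A]
    [TopologicalSpace B] [T2Space B] {s : Set A} {t : Set B} (hs : IsCompact s) {f : A → B}
    (hf : Continuous f) (hinj : InjOn f s) (himg : f '' s = t) : Nonempty (s ≃ₜ t) := by
  have : CompactSpace s := isCompact_iff_compactSpace.1 hs
  have hbij : BijOn f s t := ⟨fun x hx => himg ▸ mem_image_of_mem f hx, hinj, himg.ge⟩
  exact ⟨Continuous.homeoOfEquivCompactToT2 (f := hbij.equiv f)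
    ((hf.comp continuous_subtype_val).subtype_mk _)⟩

/-- The total space of a continuously varying family of convex bodies, each star-shaped about the
origin, is homeomorphic to a product with the unit ball. -/
theorem nonempty_homeomorph_prod_closedBall {X V : Type*} [TopologicalSpace X] [T2Space X]
    [NormedAddCommGroup V] [NormedSpace ℝ V] {K O : Set (X × V)}
    (hK : IsCompact K) (hO : IsOpen O) (hOK : O ⊆ K)
    (hconv : ∀ e, Convex ℝ {v | (e, v) ∈ K}) (hzero : ∀ e, (e, (0 : V)) ∈ O)
    (hscale : ∀ e v (r : ℝ), (e, v) ∈ K → 0 ≤ r → r < 1 → (e, r • v) ∈ O) :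
    Nonempty (K ≃ₜ X × closedBall (0 : V) 1) := by
  set C : X → Set V := fun e => {v | (e, v) ∈ K} with hC
  have hnhds (e : X) : C e ∈ 𝓝 (0 : V) := by
    have : {v | (e, v) ∈ O} ∈ 𝓝 (0 : V) :=
      (hO.preimage (Continuous.prodMk_right e)).mem_nhds (hzero e)
    exact Filter.mem_of_superset this fun v hv => hOK hv
  have hclosed (e : X) : IsClosed (C e) := (hK.isClosed).preimage (Continuous.prodMk_right e)
  have hbdd (e : X) : Bornology.IsVonNBounded ℝ (C e) := by
    rw [NormedSpace.isVonNBounded_iff]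
    exact (hK.image continuous_snd).isBounded.subset fun v hv => ⟨(e, v), hv, rfl⟩
  have hle (e : X) (v : V) : gauge (C e) v ≤ 1 ↔ (e, v) ∈ K := by
    rw [gauge_le_one_iff_mem_closure (hconv e) (hnhds e), (hclosed e).closure_eq]; rfl
  have hlt (e : X) (v : V) : gauge (C e) v < 1 ↔ (e, v) ∈ O := by
    constructor
    · intro h
      obtain ⟨b, hb0, hb1, w, hw, rfl⟩ := exists_lt_of_gauge_lt (absorbent_nhds_zero (hnhds e)) h
      exact hscale e w b hw hb0.le hb1
    · intro h
      apply interior_subset_gauge_lt_one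
      refine mem_interior.2 ⟨{v | (e, v) ∈ O}, fun v hv => hOK hv,
        hO.preimage (Continuous.prodMk_right e), h⟩
  have hcont : Continuous fun p : X × V => gauge (C p.1) p.2 := by
    have hsc (r : ℝ) (hr : 0 < r) (p : X × V) :
        gauge (C p.1) (r⁻¹ • p.2) = gauge (C p.1) p.2 / r := by
      rw [gauge_smul_of_nonneg (inv_nonneg.2 hr.le), smul_eq_mul]; ring
    have hcs (r : ℝ) : Continuous fun p : X × V => (p.1, r⁻¹ • p.2) := by fun_prop
    rw [continuous_iff_lower_upperSemicontinuous]
    constructor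
    · intro p a ha
      change a < gauge (C p.1) p.2 at ha
      obtain ha0 | ha0 := lt_or_ge a 0
      · exact Filter.Eventually.of_forall fun q => ha0.trans_le (gauge_nonneg _)
      obtain ⟨b, hab, hb⟩ := exists_between ha
      have hb0 : 0 < b := ha0.trans_lt hab
      have : {q : X × V | (q.1, b⁻¹ • q.2) ∉ K} ∈ 𝓝 p := by
        refine ((hK.isClosed.isOpen_compl).preimage (hcs b)).mem_nhds ?_
        change (p.1, b⁻¹ • p.2) ∉ K
        rw [← hle, hsc b hb0, div_le_one hb0]; exact hb.not_ge
      filter_upwards [this] with q hq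
      have hq : (q.1, b⁻¹ • q.2) ∉ K := hq
      rw [← hle, hsc b hb0, div_le_one hb0, not_le] at hq
      exact hab.trans hq
    · intro p a ha
      change gauge (C p.1) p.2 < a at ha
      have ha0 : 0 < a := (gauge_nonneg _).trans_lt ha
      have : {q : X × V | (q.1, a⁻¹ • q.2) ∈ O} ∈ 𝓝 p := by
        refine (hO.preimage (hcs a)).mem_nhds ?_
        change (p.1, a⁻¹ • p.2) ∈ O
        rw [← hlt, hsc a ha0, div_lt_one ha0]; exact ha
      filter_upwards [this] with q hq
      have hq : (q.1, a⁻¹ • q.2) ∈ O := hq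
      rwa [← hlt, hsc a ha0, div_lt_one ha0] at hq
  have hball : ball (0 : V) 1 ∈ 𝓝 (0 : V) := ball_mem_nhds 0 one_pos
  have hballb : Bornology.IsVonNBounded ℝ (ball (0 : V) 1) :=
    (NormedSpace.isVonNBounded_iff ℝ).2 isBounded_ball
  let F : X × V → X × V := fun p => (p.1, gaugeRescale (C p.1) (ball 0 1) p.2)
  have hF : Continuous F := by
    refine continuous_fst.prodMk ?_
    have hform (p : X × V) : gaugeRescale (C p.1) (ball (0 : V) 1) p.2
        = (gauge (C p.1) p.2 / ‖p.2‖) • p.2 := by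
      rw [gaugeRescale_def, gauge_unit_ball]
    simp_rw [hform]
    rw [continuous_iff_continuousAt]
    rintro ⟨e, v⟩
    by_cases hv : v = 0
    · subst hv
      unfold ContinuousAt
      simp only [smul_zero]
      rw [tendsto_zero_iff_norm_tendsto_zero]
      have h0 := (hcont.tendsto (e, (0 : V)))
      simp only [gauge_zero] at h0
      refine squeeze_zero (fun _ => norm_nonneg _) (fun p => ?_) h0
      rw [norm_smul, norm_div, norm_norm, Real.norm_of_nonneg (gauge_nonneg _)]
      obtain h | h := (norm_nonneg p.2).eq_or_lt
      · rw [← h, mul_zero]; exact gauge_nonneg _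
      · rw [div_mul_cancel₀ _ h.ne']
    · exact ((hcont.continuousAt.div continuous_snd.norm.continuousAt (norm_ne_zero_iff.2 hv)).smul
        continuous_snd.continuousAt)
  have hinj : InjOn F K := by
    rintro ⟨e, v⟩ - ⟨e', v'⟩ - h
    obtain ⟨h1, h⟩ := Prod.mk.inj h
    dsimp only at h1
    subst h1
    have := (gaugeRescaleEquiv (C e) (ball (0 : V) 1) (absorbent_nhds_zero (hnhds e)) (hbdd e)
      (absorbent_nhds_zero hball) hballb).injective h
    exact congrArg (Prod.mk e) this
  have himg : F '' K = univ ×ˢ closedBall (0 : V) 1 := by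
    have hfib (e : X) : gaugeRescale (C e) (ball 0 1) '' C e = closedBall (0 : V) 1 := by
      have := image_gaugeRescaleHomeomorph_closure (hconv e) (hnhds e) (hbdd e)
        (convex_ball (0 : V) 1) hball hballb
      rwa [(hclosed e).closure_eq, closure_ball _ one_ne_zero] at this
    ext ⟨e, w⟩
    simp only [mem_prod, mem_univ, true_and]
    rw [← hfib e]
    constructor
    · rintro ⟨⟨e', v⟩, hv, h⟩
      obtain ⟨h1, h2⟩ := Prod.mk.inj h
      dsimp only at h1
      subst h1
      exact ⟨v, hv, h2⟩
    · rintro ⟨v, hv, rfl⟩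
      exact ⟨(e, v), hv, rfl⟩
  obtain ⟨φ⟩ := hK.nonempty_homeomorph_image hF hinj himg
  exact ⟨φ.trans ((Homeomorph.Set.prod _ _).trans
    ((Homeomorph.Set.univ X).prodCongr (Homeomorph.refl _)))⟩

local notation "E2" => EuclideanSpace ℝ (Fin 2)
local notation "E3" => EuclideanSpace ℝ (Fin 3)

/-- The wedge of the unit ball about the first axis, cut out by two planes through the last axis;
`τ` is the cotangent of half of the opening angle. -/
def ballWedge (τ : ℝ) : Set E3 :=
  {x | ‖x‖ ≤ 1 ∧ τ * x 1 ≤ x 0 ∧ -(τ * x 1) ≤ x 0}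

/-- Distance to the line through `(0, -μ, 0)` parallel to the first axis. -/
noncomputable def axisDist (μ : ℝ) (x : E3) : ℝ := ‖(!₂[x 1 + μ, x 2] : E2)‖

/-- A function that is nonpositive exactly on a cone around the line through `(0, -μ, 0)`
parallel to the first axis. -/
noncomputable def coneFun (μ : ℝ) (x : E3) : ℝ := axisDist μ x - (μ / 2 - μ / 4 * x 0)

/-- The wedge with the open cone removed. -/
def drilledWedge (τ μ : ℝ) : Set E3 := {x | x ∈ ballWedge τ ∧ 0 ≤ coneFun μ x}

/-- The part of the wedge in the closed cone. -/
def wedgePlug (τ μ : ℝ) : Set E3 := {x | x ∈ ballWedge τ ∧ coneFun μ x ≤ 0}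

theorem norm_sq_E3 (x : E3) : ‖x‖ ^ 2 = x 0 ^ 2 + x 1 ^ 2 + x 2 ^ 2 := by
  simp [EuclideanSpace.norm_sq_eq, Fin.sum_univ_three]

theorem norm_sq_E2 (x : E2) : ‖x‖ ^ 2 = x 0 ^ 2 + x 1 ^ 2 := by
  simp [EuclideanSpace.norm_sq_eq, Fin.sum_univ_two]

theorem norm_le_one_iff_E3 (x : E3) : ‖x‖ ≤ 1 ↔ x 0 ^ 2 + x 1 ^ 2 + x 2 ^ 2 ≤ 1 := by
  rw [← norm_sq_E3, sq_le_one_iff₀ (norm_nonneg _)]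

theorem axisDist_nonneg (μ : ℝ) (x : E3) : 0 ≤ axisDist μ x := norm_nonneg _

theorem axisDist_sq (μ : ℝ) (x : E3) : axisDist μ x ^ 2 = (x 1 + μ) ^ 2 + x 2 ^ 2 := by
  simp [axisDist, norm_sq_E2]

theorem le_axisDist (μ : ℝ) (x : E3) : x 1 + μ ≤ axisDist μ x := by
  have := axisDist_sq μ x
  nlinarith [axisDist_nonneg μ x, sq_nonneg (x 2)]

@[fun_prop]
theorem continuous_axisDist (μ : ℝ) : Continuous (axisDist μ) := by
  unfold axisDist
  fun_prop

@[fun_prop]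
theorem continuous_coneFun (μ : ℝ) : Continuous (coneFun μ) := by
  unfold coneFun
  fun_prop

theorem isClosed_ballWedge (τ : ℝ) : IsClosed (ballWedge τ) := by
  refine IsClosed.and (isClosed_le ?_ ?_) (IsClosed.and (isClosed_le ?_ ?_) (isClosed_le ?_ ?_)) <;>
    fun_prop

theorem isClosed_drilledWedge (τ μ : ℝ) : IsClosed (drilledWedge τ μ) :=
  IsClosed.and (isClosed_ballWedge τ) (isClosed_le continuous_const (continuous_coneFun μ))

theorem isClosed_wedgePlug (τ μ : ℝ) : IsClosed (wedgePlug τ μ) :=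
  IsClosed.and (isClosed_ballWedge τ) (isClosed_le (continuous_coneFun μ) continuous_const)

/-- Cylindrical coordinates about the line through `(0, -μ, 0)` parallel to the first axis. -/
noncomputable def cylCoord (μ : ℝ) (p : E2 × E2) : E3 :=
  !₂[1 / 2 + p.2 1, -μ + (μ / 2 + p.2 0) * p.1 0, (μ / 2 + p.2 0) * p.1 1]

@[fun_prop]
theorem continuous_cylCoord (μ : ℝ) : Continuous (cylCoord μ) := by
  unfold cylCoord
  fun_prop

theorem axisDist_cylCoord {μ : ℝ} {p : E2 × E2} (hp : ‖p.1‖ = 1) (h : 0 ≤ μ / 2 + p.2 0) :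
    axisDist μ (cylCoord μ p) = μ / 2 + p.2 0 := by
  have h1 := axisDist_sq μ (cylCoord μ p)
  have h2 := norm_sq_E2 p.1
  rw [hp] at h2
  simp only [cylCoord, PiLp.toLp_apply, Matrix.cons_val] at h1
  rw [← sq_eq_sq₀ (axisDist_nonneg _ _) h]
  simp only [cylCoord]
  rw [h1]
  linear_combination -(μ / 2 + p.2 0) ^ 2 * h2

/-- The drilled wedge is a solid torus. -/
theorem nonempty_homeomorph_drilledWedge {τ μ : ℝ} (hτ : 0 < τ) (hμ : 0 < μ) (hμ1 : μ ≤ 1 / 4)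
    (hμτ : μ * τ ≤ 1 / 4) :
    Nonempty (drilledWedge τ μ ≃ₜ sphere (0 : E2) 1 × closedBall (0 : E2) 1) := by
  let f : sphere (0 : E2) 1 × E2 → E3 := fun p => cylCoord μ (p.1, p.2)
  have hf : Continuous f := by fun_prop
  let K : Set (sphere (0 : E2) 1 × E2) :=
    {p | f p ∈ ballWedge τ ∧ μ / 2 - μ / 4 * (1 / 2 + p.2 1) ≤ μ / 2 + p.2 0}
  let O : Set (sphere (0 : E2) 1 × E2) :=
    {p | (‖f p‖ < 1 ∧ τ * f p 1 < f p 0 ∧ -(τ * f p 1) < f p 0) ∧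
      μ / 2 - μ / 4 * (1 / 2 + p.2 1) < μ / 2 + p.2 0}
  have hOK : O ⊆ K := fun p hp => ⟨⟨hp.1.1.le, hp.1.2.1.le, hp.1.2.2.le⟩, hp.2.le⟩
  have hO : IsOpen O := by
    refine IsOpen.and (IsOpen.and (isOpen_lt ?_ ?_) (IsOpen.and (isOpen_lt ?_ ?_)
      (isOpen_lt ?_ ?_))) (isOpen_lt ?_ ?_) <;> fun_prop
  have hKc : IsClosed K := by
    refine IsClosed.and ((isClosed_ballWedge τ).preimage hf) (isClosed_le ?_ ?_) <;> fun_prop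
  have hcomb (e : sphere (0 : E2) 1) (v w : E2) (a b : ℝ) (hab : a + b = 1) :
      f (e, a • v + b • w) = a • f (e, v) + b • f (e, w) := by
    ext i
    fin_cases i
    · simp [f, cylCoord]; linear_combination -(1 / 2) * hab
    · simp [f, cylCoord]; linear_combination (μ - μ / 2 * e.1 0) * hab
    · simp [f, cylCoord]; linear_combination -(μ / 2 * e.1 1) * hab
  have hf0 (p) : f p 0 = 1 / 2 + p.2 1 := by simp [f, cylCoord]
  have hf1 (p) : f p 1 = -μ + (μ / 2 + p.2 0) * p.1.1 0 := by simp [f, cylCoord]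
  have hf2 (p) : f p 2 = (μ / 2 + p.2 0) * p.1.1 1 := by simp [f, cylCoord]
  have hpos (p) (hp : p ∈ K) : 0 < μ / 2 + p.2 0 := by
    obtain ⟨⟨h1, -⟩, h2⟩ := hp
    rw [norm_le_one_iff_E3] at h1
    have : f p 0 ≤ 1 := by nlinarith
    rw [hf0] at this
    nlinarith
  have hcone (p) (hp : 0 ≤ μ / 2 + p.2 0) : axisDist μ (f p) = μ / 2 + p.2 0 :=
    axisDist_cylCoord (p := (p.1.1, p.2)) (by simp) hp
  have hKcompact : IsCompact K := by
    refine (isCompact_univ.prod (isCompact_closedBall (0 : E2) 4)).of_isClosed_subset hKc ?_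
    rintro p hp
    have hs := hpos p hp
    have hd := hcone p hs.le
    obtain ⟨⟨h1, -⟩, -⟩ := hp
    rw [norm_le_one_iff_E3] at h1
    have h2 := axisDist_sq μ (f p)
    rw [hd] at h2
    simp only [mem_prod, mem_univ, true_and, mem_closedBall, dist_zero_right]
    rw [← sq_le_sq₀ (norm_nonneg _) (by norm_num), norm_sq_E2]
    have ha : (p.2 1) ^ 2 ≤ 4 := by
      rw [hf0] at h1
      nlinarith
    have hb : (μ / 2 + p.2 0) ^ 2 ≤ 4 := by
      rw [h2]
      have hy : f p 1 ≤ 1 := by nlinarith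
      nlinarith [mul_nonneg hμ.le (sub_nonneg.2 hy)]
    have hc : (p.2 0) ^ 2 ≤ 9 := by
      nlinarith
    linarith
  have hconv (e) : Convex ℝ {v | (e, v) ∈ K} := by
    rintro v ⟨⟨hv1, hv2, hv3⟩, hv4⟩ w ⟨⟨hw1, hw2, hw3⟩, hw4⟩ a b ha hb hab
    refine ⟨⟨?_, ?_, ?_⟩, ?_⟩
    · rw [hcomb e v w a b hab, ← mem_closedBall_zero_iff]
      exact convex_closedBall (0 : E3) 1 (by simpa using hv1) (by simpa using hw1) ha hb hab
    · rw [hcomb e v w a b hab]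
      simp only [PiLp.add_apply, PiLp.smul_apply, smul_eq_mul]
      nlinarith
    · rw [hcomb e v w a b hab]
      simp only [PiLp.add_apply, PiLp.smul_apply, smul_eq_mul]
      nlinarith
    · simp only [PiLp.add_apply, PiLp.smul_apply, smul_eq_mul] at hv4 hw4 ⊢
      obtain rfl : b = 1 - a := by linarith
      nlinarith
  have hzero (e) : (e, (0 : E2)) ∈ O := by
    have he : ‖e.1‖ = 1 := by simp
    have h2 := norm_sq_E2 e.1
    rw [he] at h2
    have hu : e.1 0 ≤ 1 := by nlinarith
    have hl : -1 ≤ e.1 0 := by nlinarith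
    refine ⟨⟨?_, ?_, ?_⟩, ?_⟩
    · rw [← sq_lt_one_iff₀ (norm_nonneg _), norm_sq_E3, hf0, hf1, hf2]
      simp only [PiLp.zero_apply, add_zero]
      have h3 : μ ^ 2 ≤ 1 / 16 := by nlinarith
      have h4 : (1 / 2 : ℝ) ^ 2 + (-μ + μ / 2 * e.1 0) ^ 2 + (μ / 2 * e.1 1) ^ 2
          = 1 / 4 + μ ^ 2 * (5 / 4 - e.1 0) := by
        linear_combination -(μ ^ 2 / 4) * h2
      nlinarith [mul_nonneg (sq_nonneg μ) (by linarith : 0 ≤ e.1 0 + 1)]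
    · rw [hf0, hf1]
      simp only [PiLp.zero_apply, add_zero]
      nlinarith [mul_pos hμ hτ]
    · rw [hf0, hf1]
      simp only [PiLp.zero_apply, add_zero]
      nlinarith [mul_pos hμ hτ]
    · simp only [PiLp.zero_apply, add_zero]
      nlinarith
  have hscale (e v) (r : ℝ) (hv : (e, v) ∈ K) (hr0 : 0 ≤ r) (hr1 : r < 1) : (e, r • v) ∈ O := by
    obtain ⟨⟨hv1, hv2, hv3⟩, hv4⟩ := hv
    obtain ⟨⟨hz1, hz2, hz3⟩, hz4⟩ := hzero e
    have hc := hcomb e v 0 r (1 - r) (by ring)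
    rw [smul_zero, add_zero] at hc
    refine ⟨⟨?_, ?_, ?_⟩, ?_⟩
    · rw [hc]
      refine (norm_add_le _ _).trans_lt ?_
      rw [norm_smul, norm_smul, Real.norm_of_nonneg hr0, Real.norm_of_nonneg (by linarith)]
      nlinarith
    · rw [hc]
      simp only [PiLp.add_apply, PiLp.smul_apply, smul_eq_mul]
      nlinarith
    · rw [hc]
      simp only [PiLp.add_apply, PiLp.smul_apply, smul_eq_mul]
      nlinarith
    · simp only [PiLp.zero_apply, PiLp.smul_apply, smul_eq_mul] at hv4 hz4 ⊢
      nlinarith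
  have hinj : InjOn f K := by
    intro p hp q hq h
    have h0 := congrArg (fun x : E3 => x 0) h
    have h1 := congrArg (fun x : E3 => x 1) h
    have h2 := congrArg (fun x : E3 => x 2) h
    have h3 := congrArg (axisDist μ) h
    rw [hcone p (hpos p hp).le, hcone q (hpos q hq).le] at h3
    simp only [hf0, hf1, hf2] at h0 h1 h2
    have hs := hpos q hq
    rw [h3] at h1 h2
    refine Prod.ext (Subtype.ext ?_) ?_
    · ext i
      fin_cases i
      · exact mul_left_cancel₀ hs.ne' (add_left_cancel h1)
      · exact mul_left_cancel₀ hs.ne' h2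
    · ext i
      fin_cases i
      · exact add_left_cancel h3
      · exact add_left_cancel h0
  have himg : f '' K = drilledWedge τ μ := by
    ext x
    constructor
    · rintro ⟨p, hp, rfl⟩
      refine ⟨hp.1, ?_⟩
      rw [coneFun, hcone p (hpos p hp).le, hf0]
      linarith [hp.2]
    · rintro ⟨hx, hxc⟩
      have hx0 : x 0 ≤ 1 := by
        have := (norm_le_one_iff_E3 x).1 hx.1
        nlinarith
      rw [coneFun] at hxc
      have hd : 0 < axisDist μ x := by nlinarith
      have hsq := axisDist_sq μ x
      set d := axisDist μ x with hd_def
      have he : ‖(!₂[(x 1 + μ) / d, x 2 / d] : E2)‖ = 1 := by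
        rw [← sq_eq_sq₀ (norm_nonneg _) zero_le_one, norm_sq_E2]
        simp
        field_simp
        linarith
      have hfx : f (⟨_, mem_sphere_zero_iff_norm.2 he⟩, !₂[d - μ / 2, x 0 - 1 / 2]) = x := by
        ext i
        fin_cases i
        · simp [hf0]
        · simp [hf1]; field_simp; ring
        · simp [hf2]; field_simp
      refine ⟨_, ⟨by rwa [hfx], ?_⟩, hfx⟩
      simp
      linarith
  obtain ⟨φ⟩ := hKcompact.nonempty_homeomorph_image hf hinj himg
  obtain ⟨ψ⟩ := nonempty_homeomorph_prod_closedBall hKcompact hO hOK hconv hzero hscale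
  exact ⟨φ.symm.trans ψ⟩

/-- Rotation about the last axis. -/
noncomputable def zRotFun (θ : ℝ) (x : E3) : E3 :=
  !₂[x 0 * Real.cos θ - x 1 * Real.sin θ, x 0 * Real.sin θ + x 1 * Real.cos θ, x 2]

theorem zRotFun_zRotFun (a b : ℝ) (x : E3) : zRotFun a (zRotFun b x) = zRotFun (a + b) x := by
  ext i
  fin_cases i <;> simp [zRotFun, Real.cos_add, Real.sin_add] <;> ring

theorem zRotFun_zero (x : E3) : zRotFun 0 x = x := by
  ext i
  fin_cases i <;> simp [zRotFun]

theorem norm_zRotFun (θ : ℝ) (x : E3) : ‖zRotFun θ x‖ = ‖x‖ := by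
  rw [← sq_eq_sq₀ (norm_nonneg _) (norm_nonneg _), norm_sq_E3, norm_sq_E3]
  simp only [zRotFun, PiLp.toLp_apply, Matrix.cons_val]
  linear_combination (x 0 ^ 2 + x 1 ^ 2) * Real.sin_sq_add_cos_sq θ

/-- Rotation about the last axis, as an isometry of space. -/
noncomputable def zRot (θ : ℝ) : E3 ≃ᵢ E3 :=
  IsometryEquiv.mk' (zRotFun θ) (zRotFun (-θ))
    (fun x => by rw [zRotFun_zRotFun, add_neg_cancel, zRotFun_zero]) <| by
      refine Isometry.of_dist_eq fun x y => ?_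
      rw [dist_eq_norm, dist_eq_norm, ← norm_zRotFun θ (x - y)]
      congr 1
      ext i
      fin_cases i <;> simp [zRotFun] <;> ring

theorem zRot_apply_zero (θ : ℝ) (x : E3) :
    zRot θ x 0 = x 0 * Real.cos θ - x 1 * Real.sin θ := rfl

theorem zRot_apply_one (θ : ℝ) (x : E3) :
    zRot θ x 1 = x 0 * Real.sin θ + x 1 * Real.cos θ := rfl

theorem norm_zRot (θ : ℝ) (x : E3) : ‖zRot θ x‖ = ‖x‖ := norm_zRotFun θ x

theorem zRot_zRot (a b : ℝ) (x : E3) : zRot a (zRot b x) = zRot (a + b) x := zRotFun_zRotFun a b x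

/-- The drilled wedge rotated backwards by `α`, together with the plug of the next wedge. -/
def torusTile (τ μ α : ℝ) : Set E3 := {x | zRot α x ∈ drilledWedge τ μ ∨ x ∈ wedgePlug τ μ}

/-- The upper end of the plug, in the direction of the first axis. -/
noncomputable def plugTop (μ : ℝ) (x : E3) : ℝ :=
  min ((μ / 2 - axisDist μ x) / (μ / 4)) √(1 - x 1 ^ 2 - x 2 ^ 2)

theorem coneFun_nonpos_iff {μ : ℝ} (hμ : 0 < μ) (x : E3) :
    coneFun μ x ≤ 0 ↔ x 0 ≤ (μ / 2 - axisDist μ x) / (μ / 4) := by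
  rw [le_div_iff₀ (by positivity), coneFun]
  constructor <;> intro h <;> linarith

theorem apply_one_le_of_le_plugTop {τ μ : ℝ} (hτ : 0 < τ) (hμ : 0 < μ) (hμτ : μ * τ ≤ 1 / 4) {x : E3}
    (h : -(τ * x 1) ≤ plugTop μ x) : x 1 ≤ -(μ / 2) := by
  have h1 : -(τ * x 1) ≤ (μ / 2 - axisDist μ x) / (μ / 4) := h.trans (min_le_left _ _)
  rw [le_div_iff₀ (by positivity)] at h1
  have h2 := le_axisDist μ x
  by_contra! h3
  have h4 : 0 < (x 1 + μ / 2) * (1 - μ * τ / 4) := mul_pos (by linarith) (by linarith)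
  nlinarith [mul_pos (mul_pos hμ hτ) hμ]

theorem plugTop_le_one (μ : ℝ) (x : E3) : plugTop μ x ≤ 1 := by
  refine (min_le_right _ _).trans (Real.sqrt_le_one.2 ?_)
  nlinarith [sq_nonneg (x 1), sq_nonneg (x 2)]

theorem sq_le_of_le_plugTop {μ t : ℝ} {x : E3} (ht : 0 < t) (h : t ≤ plugTop μ x) :
    t ^ 2 + x 1 ^ 2 + x 2 ^ 2 ≤ 1 := by
  have h1 : t ≤ √(1 - x 1 ^ 2 - x 2 ^ 2) := h.trans (min_le_right _ _)
  rw [Real.le_sqrt' ht] at h1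
  linarith

theorem mem_wedgePlug_iff {τ μ : ℝ} (hτ : 0 < τ) (hμ : 0 < μ) (hμτ : μ * τ ≤ 1 / 4) (x : E3) :
    x ∈ wedgePlug τ μ ↔ -(τ * x 1) ≤ x 0 ∧ x 0 ≤ plugTop μ x := by
  constructor
  · rintro ⟨⟨h1, h2, h3⟩, h4⟩
    refine ⟨h3, le_min ((coneFun_nonpos_iff hμ x).1 h4) (Real.le_sqrt_of_sq_le ?_)⟩
    rw [norm_le_one_iff_E3] at h1
    linarith
  · rintro ⟨h1, h2⟩
    have h3 := apply_one_le_of_le_plugTop hτ hμ hμτ (h1.trans h2)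
    have h4 : 0 < x 0 := by nlinarith
    refine ⟨⟨?_, by nlinarith, h1⟩, (coneFun_nonpos_iff hμ x).2 (h2.trans (min_le_left _ _))⟩
    rw [norm_le_one_iff_E3]
    exact sq_le_of_le_plugTop h4 h2

/-- If `α` is the opening angle of a wedge, then the rotated wedge lies below the face of the
wedge. -/
theorem apply_zero_le_of_zRot_mem {τ α : ℝ} (h1 : τ * Real.sin α = 1 + Real.cos α)
    (h2 : τ * (1 - Real.cos α) = Real.sin α) {x : E3} (hx : zRot α x ∈ ballWedge τ) :
    x 0 ≤ -(τ * x 1) := by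
  obtain ⟨-, h, -⟩ := hx
  rw [zRot_apply_zero, zRot_apply_one] at h
  have h3 : x 0 * Real.cos α - x 1 * Real.sin α - τ * (x 0 * Real.sin α + x 1 * Real.cos α)
      = -(x 0) - τ * x 1 := by
    linear_combination -(x 0) * h1 + x 1 * h2
  linarith

/-- The drilled wedge rotated backwards contains a neighbourhood of the base of the plug in the
half-space below the face. -/
theorem zRot_mem_drilledWedge {τ μ α c : ℝ} (hτ : 0 < τ) (hμ : 0 < μ)
    (hμτ : μ * τ ≤ 1 / 4) (hc0 : 0 ≤ c) (hc1 : c ≤ μ / 2) (hc2 : c ≤ τ * (μ / 2))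
    (hα : 0 ≤ Real.sin α) (h1 : τ * Real.sin α = 1 + Real.cos α)
    (h2 : τ * (1 - Real.cos α) = Real.sin α) {x : E3} (hx : -(τ * x 1) ≤ plugTop μ x)
    (hx1 : x 0 ≤ -(τ * x 1)) (hx2 : -(τ * x 1) - c * (plugTop μ x + τ * x 1) ≤ x 0) :
    zRot α x ∈ drilledWedge τ μ := by
  have hy := apply_one_le_of_le_plugTop hτ hμ hμτ hx
  have hm := plugTop_le_one μ x
  have hL : τ * (μ / 2) ≤ -(τ * x 1) := by nlinarith
  have hL0 : 0 < τ * (μ / 2) := by positivity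
  obtain ⟨ξ, hξ⟩ : ∃ ξ, ξ = -(τ * x 1) - x 0 := ⟨_, rfl⟩
  have hξ0 : 0 ≤ ξ := by linarith
  have hξc : ξ ≤ c := by nlinarith
  have hX : zRot α x 0 = -(τ * x 1) - ξ * Real.cos α := by
    rw [zRot_apply_zero, hξ]; linear_combination x 1 * h2
  have hY : zRot α x 1 = -(x 1) - ξ * Real.sin α := by
    rw [zRot_apply_one, hξ]; linear_combination -(x 1) * h1
  have hY0 : 0 ≤ zRot α x 1 := by
    rw [hY]; nlinarith [Real.sin_le_one α]
  have hXY : zRot α x 0 = τ * zRot α x 1 + ξ := by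
    rw [hX, hY]; linear_combination ξ * h1
  have hX0 : 0 ≤ zRot α x 0 := by rw [hXY]; positivity
  refine ⟨⟨?_, by linarith, by nlinarith⟩, ?_⟩
  · rw [norm_zRot, norm_le_one_iff_E3]
    have := sq_le_of_le_plugTop (hL0.trans_le hL) hx
    nlinarith
  · have := le_axisDist μ (zRot α x)
    rw [coneFun]
    nlinarith

/-- Absorbing the plug into the drilled wedge to which it is attached shows that the tile is
homeomorphic to the drilled wedge. -/
theorem nonempty_homeomorph_torusTile {τ μ α : ℝ} (hτ : 0 < τ) (hμ : 0 < μ)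
    (hμτ : μ * τ ≤ 1 / 4) (hα : 0 ≤ Real.sin α) (h1 : τ * Real.sin α = 1 + Real.cos α)
    (h2 : τ * (1 - Real.cos α) = Real.sin α) :
    Nonempty (torusTile τ μ α ≃ₜ drilledWedge τ μ) := by
  obtain ⟨c, hc0, hc1, hc2⟩ : ∃ c, 0 < c ∧ c ≤ μ / 2 ∧ c ≤ τ * (μ / 2) :=
    ⟨min (μ / 2) (τ * (μ / 2)), by positivity, min_le_left _ _, min_le_right _ _⟩
  obtain ⟨κ, hκ⟩ : ∃ κ, κ = c / (1 + c) := ⟨_, rfl⟩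
  have hκ0 : 0 < κ := by rw [hκ]; positivity
  have hκc : κ * (1 + c) = c := by rw [hκ]; field_simp
  have hκ1 : κ < 1 := by nlinarith
  have hκc' : κ < c := by nlinarith
  let G : E3 → ℝ := fun x => max (-(τ * x 1)) (plugTop μ x)
  let Ψ : E3 → E3 := fun x => !₂[min (x 0) (-(τ * x 1) + κ * (x 0 - G x)), x 1, x 2]
  have hG : Continuous G := by
    unfold G plugTop
    fun_prop (disch := positivity)
  have hΨ : Continuous Ψ := by fun_prop
  have hGcongr (x y : E3) (h1 : x 1 = y 1) (h2 : x 2 = y 2) : G x = G y := by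
    simp only [G, plugTop, axisDist, h1, h2]
  have hinj : Function.Injective Ψ := by
    intro x y h
    have e0 := congrArg (fun x : E3 => x 0) h
    have e1 := congrArg (fun v : E3 => v 1) h
    have e2 := congrArg (fun v : E3 => v 2) h
    change x 1 = y 1 at e1
    change x 2 = y 2 at e2
    simp only [Ψ, Matrix.cons_val, hGcongr x y e1 e2, e1] at e0
    have e3 : x 0 = y 0 := by
      obtain h | h | h := lt_trichotomy (x 0) (y 0)
      · refine absurd e0 (ne_of_lt (min_lt_min h ?_))
        nlinarith
      · exact h
      · refine absurd e0 (ne_of_gt (min_lt_min h ?_))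
        nlinarith
    ext i
    fin_cases i <;> assumption
  have hGt (x : E3) (h : -(τ * x 1) < G x) : G x = plugTop μ x ∧ -(τ * x 1) ≤ plugTop μ x := by
    have := (lt_max_iff.1 h).resolve_left (lt_irrefl _)
    exact ⟨max_eq_right this.le, this.le⟩
  have hLG (x : E3) : -(τ * x 1) ≤ G x := le_max_left _ _
  have hlens (x : E3) (h : -(τ * x 1) ≤ plugTop μ x) (hx1 : x 0 ≤ -(τ * x 1))
      (hx2 : -(τ * x 1) - c * (G x + τ * x 1) ≤ x 0) : zRot α x ∈ drilledWedge τ μ := by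
    refine zRot_mem_drilledWedge hτ hμ hμτ hc0.le hc1 hc2 hα h1 h2 h hx1 ?_
    rwa [show G x = plugTop μ x from max_eq_right h] at hx2
  have hfix (x : E3) (h : x 0 ≤ -(τ * x 1) + κ * (x 0 - G x)) : Ψ x = x := by
    ext i
    fin_cases i <;> simp [Ψ, h]
  have hmove (x : E3) (h : -(τ * x 1) + κ * (x 0 - G x) ≤ x 0) :
      Ψ x 0 = -(τ * x 1) + κ * (x 0 - G x) := by
    simp [Ψ, h]
  have hcritical (x : E3) :
      x 0 ≤ -(τ * x 1) + κ * (x 0 - G x) ↔ x 0 ≤ -(τ * x 1) - c * (G x + τ * x 1) := by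
    have : (1 + c) * (-(τ * x 1) + κ * (x 0 - G x) - x 0)
      = -(τ * x 1) - c * (G x + τ * x 1) - x 0 := by
      linear_combination (x 0 - G x) * hκc
    constructor <;> intro h <;> nlinarith
  have himg : Ψ '' torusTile τ μ α = zRot α ⁻¹' drilledWedge τ μ := by
    ext x
    simp only [mem_image, mem_preimage]
    constructor
    · rintro ⟨x, hx, rfl⟩
      by_cases hcase : x 0 ≤ -(τ * x 1) + κ * (x 0 - G x)
      · rw [hfix x hcase]
        obtain hx | hx := hx
        · exact hx
        · rw [mem_wedgePlug_iff hτ hμ hμτ] at hx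
          have := hLG x
          refine hlens x (hx.1.trans hx.2) ?_ ?_
          · have := (hcritical x).1 hcase
            nlinarith
          · nlinarith
      · have hm := hmove x (not_le.1 hcase).le
        rw [hcritical, not_le] at hcase
        have hGx := hLG x
        have hle : -(τ * x 1) ≤ plugTop μ x ∧ x 0 ≤ G x := by
          obtain hx | hx := hx
          · have hx0 := apply_zero_le_of_zRot_mem h1 h2 hx.1
            refine ⟨(hGt x (hGx.lt_of_ne fun h => ?_)).2, hx0.trans hGx⟩
            rw [← h] at hcase
            linarith
          · rw [mem_wedgePlug_iff hτ hμ hμτ] at hx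
            exact ⟨hx.1.trans hx.2, hx.2.trans (le_max_right _ _)⟩
        have hG1 : G (Ψ x) = G x := hGcongr _ _ rfl rfl
        have hp1 : plugTop μ (Ψ x) = plugTop μ x := rfl
        have hy1 : Ψ x 1 = x 1 := rfl
        refine hlens (Ψ x) ?_ ?_ ?_
        · rw [hp1, hy1]; exact hle.1
        · rw [hm, hy1]; nlinarith
        · rw [hm, hy1, hG1]
          nlinarith
    · intro hx
      have hx0 := apply_zero_le_of_zRot_mem h1 h2 hx.1
      by_cases hcase : x 0 ≤ -(τ * x 1) + κ * (x 0 - G x)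
      · exact ⟨x, Or.inl hx, hfix x hcase⟩
      · rw [hcritical, not_le] at hcase
        have hGx := hGt x ((hLG x).lt_of_ne fun h => by rw [← h] at hcase; linarith)
        let y : E3 := !₂[G x + (x 0 + τ * x 1) / κ, x 1, x 2]
        have hy0 : y 0 = G x + (x 0 + τ * x 1) / κ := rfl
        have hy1 : y 1 = x 1 := rfl
        have hGy : G y = G x := hGcongr _ _ rfl rfl
        have hyx : κ * (y 0 - G x) = x 0 + τ * x 1 := by rw [hy0]; field_simp; ring
        have hyG : y 0 ≤ G x := by nlinarith
        have hlow : -(τ * x 1) - c * (G x + τ * x 1) < y 0 := by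
          by_contra! hcon
          nlinarith
        refine ⟨y, ?_, ?_⟩
        · obtain h | h := le_total (y 0) (-(τ * x 1))
          · exact Or.inl (hlens y hGx.2 h (by rw [hGy, hy1]; exact hlow.le))
          · exact Or.inr ((mem_wedgePlug_iff hτ hμ hμτ y).2 ⟨h, hyG.trans hGx.1.le⟩)
        · have hm := hmove y (by
            by_contra! hcon
            have := (hcritical y).1 hcon.le
            rw [hy1, hGy] at this
            linarith)
          ext i
          fin_cases i
          · change Ψ y 0 = x 0
            rw [hm, hy1, hGy, hyx]; ring
          · rfl
          · rfl
  have hcl : IsClosed (torusTile τ μ α) :=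
    IsClosed.union ((isClosed_drilledWedge τ μ).preimage (zRot α).continuous) (isClosed_wedgePlug τ μ)
  have hcompact : IsCompact (torusTile τ μ α) := by
    refine (isCompact_closedBall (0 : E3) 1).of_isClosed_subset hcl ?_
    rintro x (hx | hx)
    · rw [mem_closedBall_zero_iff, ← norm_zRot α]; exact hx.1.1
    · rw [mem_closedBall_zero_iff]; exact hx.1.1
  obtain ⟨φ⟩ := hcompact.nonempty_homeomorph_image hΨ hinj.injOn himg
  exact ⟨φ.trans ((zRot α).toHomeomorph.sets rfl)⟩

/-- Rotation about the last axis by `-k / n` of a full turn. -/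
noncomputable def zTurn (n : ℕ) (k : ℤ) : E3 ≃ᵢ E3 := zRot (-(k * (2 * Real.pi / n)))

theorem zRot_zTurn (n : ℕ) (k : ℤ) (x : E3) :
    zRot (2 * Real.pi / n) (zTurn n k x) = zTurn n (k - 1) x := by
  rw [zTurn, zTurn, zRot_zRot]
  congr 2
  push_cast
  ring

theorem zTurn_zTurn (n : ℕ) (k l : ℤ) (x : E3) :
    zTurn n k (zTurn n l x) = zTurn n (k + l) x := by
  rw [zTurn, zTurn, zTurn, zRot_zRot]
  congr 2
  push_cast
  ring

theorem norm_zTurn (n : ℕ) (k : ℤ) (x : E3) : ‖zTurn n k x‖ = ‖x‖ := norm_zRot _ x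

theorem zTurn_apply_zero (n : ℕ) (k : ℤ) (x : E3) : zTurn n k x 0 =
    x 0 * Real.cos (k * (2 * Real.pi / n)) + x 1 * Real.sin (k * (2 * Real.pi / n)) := by
  rw [zTurn, zRot_apply_zero, Real.cos_neg, Real.sin_neg]
  ring

theorem zTurn_congr {n : ℕ} (hn : n ≠ 0) {k l : ℤ} (h : (n : ℤ) ∣ k - l) :
    zTurn n k = zTurn n l := by
  obtain ⟨q, hq⟩ := h
  have hq' : (k : ℝ) = l + n * q := by exact_mod_cast (by linarith : k = l + n * q)
  have hn' : (n : ℝ) ≠ 0 := Nat.cast_ne_zero.2 hn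
  have hang : -((k : ℝ) * (2 * Real.pi / n)) = -(l * (2 * Real.pi / n)) - q * (2 * Real.pi) := by
    rw [hq']; field_simp; ring
  ext x i
  simp only [zTurn]
  rw [hang]
  change zRotFun _ x i = zRotFun _ x i
  simp only [zRotFun, Real.cos_sub_int_mul_two_pi, Real.sin_sub_int_mul_two_pi]

theorem exists_fin_dvd_sub {n : ℕ} (hn : n ≠ 0) (k : ℤ) : ∃ i : Fin n, (n : ℤ) ∣ (i : ℕ) - k := by
  have hn' : (n : ℤ) ≠ 0 := Nat.cast_ne_zero.2 hn
  have h0 := Int.emod_nonneg k hn'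
  have h1 := Int.emod_lt_of_pos k (by omega : (0 : ℤ) < n)
  refine ⟨⟨(k % n).toNat, by omega⟩, ?_⟩
  rw [Int.toNat_of_nonneg h0]
  exact Int.dvd_sub_self_of_emod_eq rfl

/-- A point of the wedge has the largest first coordinate among its rotates. -/
theorem zTurn_apply_zero_le {n : ℕ} (hn : 2 ≤ n) {x : E3}
    (hx : x ∈ ballWedge (Real.cot (Real.pi / n))) (k : ℤ) : zTurn n k x 0 ≤ x 0 := by
  have hn0 : n ≠ 0 := by omega
  have hnr : (2 : ℝ) ≤ n := by exact_mod_cast hn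
  obtain ⟨r, hr⟩ := exists_fin_dvd_sub hn0 k
  rw [← zTurn_congr hn0 hr, zTurn_apply_zero]
  set β := Real.pi / n with hβ
  have hβ0 : 0 < β := by positivity
  have hβn : n * β = Real.pi := by rw [hβ]; field_simp
  have hβ1 : β ≤ Real.pi / 2 := by nlinarith
  have hsin : 0 < Real.sin β := Real.sin_pos_of_pos_of_lt_pi hβ0 (by linarith [Real.pi_pos])
  have hang : ((r : ℕ) : ℤ) * (2 * Real.pi / n) = 2 * ((r : ℕ) * β) := by
    rw [hβ]; push_cast; ring
  rw [hang]
  obtain hr0 | hr0 := Nat.eq_zero_or_pos (r : ℕ)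
  · simp [hr0]
  have hr1 : (1 : ℝ) ≤ (r : ℕ) := by exact_mod_cast hr0
  have hr2 : ((r : ℕ) : ℝ) + 1 ≤ n := by exact_mod_cast r.2
  have hs : 0 ≤ Real.sin ((r : ℕ) * β) := Real.sin_nonneg_of_nonneg_of_le_pi (by positivity)
    (by nlinarith)
  have hm : 0 ≤ Real.sin ((r : ℕ) * β - β) :=
    Real.sin_nonneg_of_nonneg_of_le_pi (by nlinarith) (by nlinarith)
  have hp : 0 ≤ Real.sin ((r : ℕ) * β + β) :=
    Real.sin_nonneg_of_nonneg_of_le_pi (by positivity) (by nlinarith)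
  rw [Real.sin_sub] at hm
  rw [Real.sin_add] at hp
  obtain ⟨-, h1, h2⟩ := hx
  set τ := Real.cot β with hτ
  have hcos : Real.cos β = τ * Real.sin β := by
    rw [hτ, Real.cot_eq_cos_div_sin]; field_simp
  rw [Real.cos_two_mul', Real.sin_two_mul]
  set σ := Real.sin ((r : ℕ) * β)
  set γ := Real.cos ((r : ℕ) * β)
  have hsc : σ ^ 2 + γ ^ 2 = 1 := Real.sin_sq_add_cos_sq _
  rw [hcos] at hm hp
  have hγ1 : γ ≤ τ * σ := le_of_mul_le_mul_right (by linarith) hsin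
  have hγ2 : -γ ≤ τ * σ := le_of_mul_le_mul_right (by linarith) hsin
  have key : x 1 * γ ≤ x 0 * σ := by
    obtain h | h := le_total 0 (x 1)
    · nlinarith
    · nlinarith
  nlinarith

theorem exists_zTurn_mem_ballWedge {n : ℕ} (hn : n ≠ 0) {τ : ℝ}
    (hα : 0 < 1 - Real.cos (2 * Real.pi / n))
    (h2 : τ * (1 - Real.cos (2 * Real.pi / n)) = Real.sin (2 * Real.pi / n)) {x : E3}
    (hx : ‖x‖ ≤ 1) : ∃ k : ℤ, zTurn n k x ∈ ballWedge τ := by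
  have : Nonempty (Fin n) := ⟨⟨0, by omega⟩⟩
  obtain ⟨k, hk⟩ := Finite.exists_max fun k : Fin n => zTurn n (k : ℕ) x 0
  have hk' (m : ℤ) : zTurn n m x 0 ≤ zTurn n (k : ℕ) x 0 := by
    obtain ⟨i, hi⟩ := exists_fin_dvd_sub hn m
    rw [← zTurn_congr hn hi]
    exact hk i
  refine ⟨(k : ℕ), (norm_zTurn n _ x).trans_le hx, ?_, ?_⟩
  · have := hk' (1 + (k : ℕ))
    rw [← zTurn_zTurn, zTurn_apply_zero] at this
    push_cast at this
    rw [one_mul, ← h2] at this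
    refine le_of_mul_le_mul_right ?_ hα
    linarith
  · have := hk' (-1 + (k : ℕ))
    rw [← zTurn_zTurn, zTurn_apply_zero] at this
    push_cast at this
    rw [neg_one_mul, Real.cos_neg, Real.sin_neg, ← h2] at this
    refine le_of_mul_le_mul_right ?_ hα
    linarith

theorem dense_ne_zero_of_add_smul {φ : E3 → ℝ} (w : E3)
    (h : ∀ x (t : ℝ), 0 < t → φ x = 0 → φ (x + t • w) ≠ 0) : Dense {x | φ x ≠ 0} := by
  intro x
  by_cases hx : φ x = 0
  · have htend : Filter.Tendsto (fun t : ℝ => x + t • w) (𝓝[>] 0) (𝓝 x) := by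
      have : Continuous fun t : ℝ => x + t • w := by fun_prop
      simpa using (this.tendsto 0).mono_left nhdsWithin_le_nhds
    refine mem_closure_of_tendsto htend ?_
    filter_upwards [self_mem_nhdsWithin] with t ht
    exact h x t ht hx
  · exact subset_closure hx

theorem dense_coneFun_ne_zero {μ : ℝ} (hμ : 0 < μ) : Dense {x | coneFun μ x ≠ 0} := by
  refine dense_ne_zero_of_add_smul !₂[1, 0, 0] fun x t ht hx => ?_
  have : coneFun μ (x + t • !₂[1, 0, 0]) = coneFun μ x + μ / 4 * t := by
    simp [coneFun, axisDist]; ring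
  rw [this, hx]
  positivity

theorem dense_zTurn_apply_zero_ne {n : ℕ} (hn : n ≠ 0) {k l : ℤ} (h : ¬ (n : ℤ) ∣ k - l) :
    Dense {x | zTurn n k x 0 - zTurn n l x 0 ≠ 0} := by
  simp_rw [zTurn_apply_zero]
  set a := (k : ℝ) * (2 * Real.pi / n) with ha
  set b := (l : ℝ) * (2 * Real.pi / n) with hb
  refine dense_ne_zero_of_add_smul !₂[Real.cos a - Real.cos b, Real.sin a - Real.sin b, 0]
    fun x t ht hx hcon => h ?_
  simp at hcon
  have hsq : t * ((Real.cos a - Real.cos b) ^ 2 + (Real.sin a - Real.sin b) ^ 2) = 0 := by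
    linear_combination hcon - hx
  have hsq' := (mul_eq_zero.1 hsq).resolve_left ht.ne'
  have hc : Real.cos a = Real.cos b := by nlinarith
  have hs : Real.sin a = Real.sin b := by nlinarith
  obtain ⟨q, hq⟩ := Real.Angle.angle_eq_iff_two_pi_dvd_sub.1 (Real.Angle.cos_sin_inj hc hs)
  refine ⟨q, ?_⟩
  have hn' : (n : ℝ) ≠ 0 := Nat.cast_ne_zero.2 hn
  have : (k : ℝ) - l = n * q := by
    rw [ha, hb] at hq
    field_simp at hq
    have hpi := Real.pi_ne_zero
    apply mul_left_cancel₀ (mul_ne_zero two_ne_zero hpi)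
    linear_combination (2 * Real.pi) * hq
  exact_mod_cast this

/-- Points that lie on no face of a rotated wedge and on no rotated cone. -/
theorem dense_generic {n : ℕ} (hn : n ≠ 0) {μ : ℝ} (hμ : 0 < μ) :
    Dense {x | (∀ k l : ℤ, ¬ (n : ℤ) ∣ k - l → zTurn n k x 0 - zTurn n l x 0 ≠ 0) ∧
      ∀ k : ℤ, coneFun μ (zTurn n k x) ≠ 0} := by
  let U : {p : ℤ × ℤ // ¬ (n : ℤ) ∣ p.1 - p.2} ⊕ ℤ → Set E3 :=
    Sum.elim (fun p => {x | zTurn n p.1.1 x 0 - zTurn n p.1.2 x 0 ≠ 0})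
      (fun k => zTurn n k ⁻¹' {x | coneFun μ x ≠ 0})
  have hU : Dense (⋂ i, U i) := by
    refine dense_iInter_of_isOpen ?_ ?_
    · rintro (p | k)
      · have := (zTurn n p.1.1).continuous
        have := (zTurn n p.1.2).continuous
        exact isOpen_ne_fun (by fun_prop) (by fun_prop)
      · exact (isOpen_ne_fun (continuous_coneFun μ) continuous_const).preimage
          (zTurn n k).continuous
    · rintro (p | k)
      · exact dense_zTurn_apply_zero_ne hn p.2
      · exact (dense_coneFun_ne_zero hμ).preimage (zTurn n k).toHomeomorph.isOpenMap
  refine hU.mono fun x hx => ?_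
  rw [mem_iInter] at hx
  exact ⟨fun k l h => hx (Sum.inl ⟨(k, l), h⟩), fun k => hx (Sum.inr k)⟩

/-- Two rotates of the tile whose interiors meet are rotates by the same angle. -/
theorem dvd_of_interior_inter_nonempty {n : ℕ} (hn : 2 ≤ n) {μ : ℝ} (hμ : 0 < μ) {i j : ℤ}
    (h : (interior (zTurn n i ⁻¹' torusTile (Real.cot (Real.pi / n)) μ (2 * Real.pi / n)) ∩
      interior (zTurn n j ⁻¹' torusTile (Real.cot (Real.pi / n)) μ (2 * Real.pi / n))).Nonempty) :
    (n : ℤ) ∣ i - j := by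
  have hn0 : n ≠ 0 := by omega
  obtain ⟨x, ⟨hxi, hxj⟩, hx1, hx2⟩ :=
    (dense_generic hn0 hμ).inter_open_nonempty _ (isOpen_interior.inter isOpen_interior) h
  have huniq (k l : ℤ) (hk : zTurn n k x ∈ ballWedge (Real.cot (Real.pi / n)))
      (hl : zTurn n l x ∈ ballWedge (Real.cot (Real.pi / n))) : (n : ℤ) ∣ k - l := by
    by_contra hcon
    refine hx1 k l hcon (sub_eq_zero.2 (le_antisymm ?_ ?_))
    · have := zTurn_apply_zero_le hn hl (k - l)
      rwa [zTurn_zTurn, sub_add_cancel] at this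
    · have := zTurn_apply_zero_le hn hk (l - k)
      rwa [zTurn_zTurn, sub_add_cancel] at this
  have hmix (k l : ℤ) (hk : zTurn n k x ∈ drilledWedge (Real.cot (Real.pi / n)) μ)
      (hl : zTurn n l x ∈ wedgePlug (Real.cot (Real.pi / n)) μ) : False := by
    have heq := zTurn_congr hn0 (huniq k l hk.1 hl.1)
    refine hx2 k (le_antisymm ?_ hk.2)
    rw [heq]
    exact hl.2
  have hi := interior_subset hxi
  have hj := interior_subset hxj
  simp only [torusTile, mem_preimage, mem_ofPred_eq, zRot_zTurn] at hi hj
  obtain hi | hi := hi <;> obtain hj | hj := hj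
  · simpa using huniq _ _ hi.1 hj.1
  · exact (hmix _ _ hi hj).elim
  · exact (hmix _ _ hj hi).elim
  · exact huniq _ _ hi.1 hj.1

theorem interior_drilledWedge_nonempty (τ : ℝ) {μ : ℝ} (hμ : 0 < μ) :
    (interior (drilledWedge τ μ)).Nonempty := by
  refine ⟨!₂[1 / 2, 0, 0], mem_interior.2 ⟨{x | (‖x‖ < 1 ∧ τ * x 1 < x 0 ∧ -(τ * x 1) < x 0) ∧
    0 < coneFun μ x}, ?_, ?_, ?_⟩⟩
  · rintro x ⟨⟨h1, h2, h3⟩, h4⟩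
    exact ⟨⟨h1.le, h2.le, h3.le⟩, h4.le⟩
  · refine IsOpen.and (IsOpen.and (isOpen_lt ?_ ?_) (IsOpen.and (isOpen_lt ?_ ?_)
      (isOpen_lt ?_ ?_))) (isOpen_lt ?_ ?_) <;> fun_prop
  · refine ⟨⟨?_, by simp, by simp⟩, ?_⟩
    · rw [← sq_lt_one_iff₀ (norm_nonneg _), norm_sq_E3]
      simp
      norm_num
    · have := le_axisDist μ !₂[1 / 2, 0, 0]
      simp at this
      simp [coneFun]
      linarith

/-- **Oh's theorem / Corollary 3.2 (ball version).** For every `n ≥ 3`, the closed unit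
ball `B³ ⊆ ℝ³` admits a monohedral tiling by `n` tiles, each homeomorphic to the solid
torus `S¹ × D²`. -/
theorem unitBall3_monohedral_tiling_solid_torus (n : ℕ) (hn : 3 ≤ n) :
    ∃ T : Fin n → Set (EuclideanSpace ℝ (Fin 3)),
      (⋃ i, T i) = Metric.closedBall (0 : EuclideanSpace ℝ (Fin 3)) 1 ∧
      (∀ i, IsCompact (T i)) ∧
      (∀ i, IsConnected (T i)) ∧
      (∀ i, (interior (T i)).Nonempty) ∧
      (∀ i j, i ≠ j → interior (T i) ∩ interior (T j) = ∅) ∧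
      (∀ i j, ∃ f : EuclideanSpace ℝ (Fin 3) ≃ᵢ EuclideanSpace ℝ (Fin 3),
        f '' (T i) = T j) ∧
      (∀ i, Nonempty ((T i) ≃ₜ
        (Metric.sphere (0 : EuclideanSpace ℝ (Fin 2)) 1 ×
          Metric.closedBall (0 : EuclideanSpace ℝ (Fin 2)) 1))) := by
  have hn0 : n ≠ 0 := by omega
  have hnr : (3 : ℝ) ≤ n := by exact_mod_cast hn
  set β := Real.pi / n with hβ
  have hβ0 : 0 < β := by positivity
  have hβn : n * β = Real.pi := by rw [hβ]; field_simp
  have hβ1 : β < Real.pi / 2 := by nlinarith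
  have hsin : 0 < Real.sin β := Real.sin_pos_of_pos_of_lt_pi hβ0 (by linarith [Real.pi_pos])
  have hcos : 0 < Real.cos β := Real.cos_pos_of_mem_Ioo ⟨by linarith [Real.pi_pos], hβ1⟩
  have hsc := Real.sin_sq_add_cos_sq β
  set τ := Real.cot β with hτ_def
  have hτc : τ * Real.sin β = Real.cos β := by
    rw [hτ_def, Real.cot_eq_cos_div_sin]; field_simp
  have hτ : 0 < τ := by
    rw [hτ_def, Real.cot_eq_cos_div_sin]; positivity
  set α := 2 * Real.pi / n with hα_def
  have hα : α = 2 * β := by rw [hα_def, hβ]; ring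
  have hsα : Real.sin α = 2 * Real.sin β * Real.cos β := by rw [hα, Real.sin_two_mul]
  have hcα : Real.cos α = Real.cos β ^ 2 - Real.sin β ^ 2 := by rw [hα, Real.cos_two_mul']
  have hsα0 : 0 ≤ Real.sin α := by rw [hsα]; positivity
  have hcα1 : 1 - Real.cos α = 2 * Real.sin β ^ 2 := by rw [hcα]; linear_combination -hsc
  have hcα0 : 0 < 1 - Real.cos α := by rw [hcα1]; positivity
  have h1 : τ * Real.sin α = 1 + Real.cos α := by
    rw [hsα, hcα]; linear_combination (2 * Real.cos β) * hτc + hsc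
  have h2 : τ * (1 - Real.cos α) = Real.sin α := by
    rw [hcα1, hsα]; linear_combination (2 * Real.sin β) * hτc
  obtain ⟨μ, hμ, hμ1, hμτ⟩ : ∃ μ : ℝ, 0 < μ ∧ μ ≤ 1 / 4 ∧ μ * τ ≤ 1 / 4 := by
    refine ⟨1 / (4 * (1 + τ)), by positivity, ?_, ?_⟩
    · rw [div_le_div_iff₀ (by positivity) (by positivity)]; linarith
    · rw [div_mul_eq_mul_div, div_le_div_iff₀ (by positivity) (by positivity)]; linarith
  have hhomeo (i : ℤ) : Nonempty (zTurn n i ⁻¹' torusTile τ μ α ≃ₜ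
      sphere (0 : E2) 1 × closedBall (0 : E2) 1) := by
    obtain ⟨φ⟩ := nonempty_homeomorph_torusTile hτ hμ hμτ hsα0 h1 h2
    obtain ⟨ψ⟩ := nonempty_homeomorph_drilledWedge hτ hμ hμ1 hμτ
    exact ⟨((zTurn n i).toHomeomorph.sets rfl).trans (φ.trans ψ)⟩
  refine ⟨fun i => zTurn n (i : ℕ) ⁻¹' torusTile τ μ α, ?_, fun i => ?_, fun i => ?_, fun i => ?_,
    fun i j hij => ?_, fun i j => ?_, fun i => hhomeo _⟩
  · ext x
    simp only [mem_iUnion, mem_preimage, torusTile, mem_ofPred_eq, mem_closedBall_zero_iff]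
    constructor
    · rintro ⟨i, hi | hi⟩
      · rw [← norm_zTurn n (i : ℕ) x, ← norm_zRot α]; exact hi.1.1
      · rw [← norm_zTurn n (i : ℕ) x]; exact hi.1.1
    · intro hx
      obtain ⟨k, hk⟩ := exists_zTurn_mem_ballWedge hn0 hcα0 h2 hx
      obtain h | h := le_total (coneFun μ (zTurn n k x)) 0
      · obtain ⟨i, hi⟩ := exists_fin_dvd_sub hn0 k
        refine ⟨i, Or.inr ?_⟩
        rw [zTurn_congr hn0 hi]
        exact ⟨hk, h⟩
      · obtain ⟨i, hi⟩ := exists_fin_dvd_sub hn0 (k + 1)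
        refine ⟨i, Or.inl ?_⟩
        rw [zTurn_congr hn0 hi, zRot_zTurn, add_sub_cancel_right]
        exact ⟨hk, h⟩
  · obtain ⟨φ⟩ := hhomeo (i : ℕ)
    exact isCompact_iff_compactSpace.2 φ.symm.compactSpace
  · obtain ⟨φ⟩ := hhomeo (i : ℕ)
    have hS : ConnectedSpace (sphere (0 : E2) 1) := by
      refine isConnected_iff_connectedSpace.1 (isConnected_sphere ?_ _ zero_le_one)
      rw [← Module.finrank_eq_rank]
      simp
    have hD : ConnectedSpace (closedBall (0 : E2) 1) :=
      isConnected_iff_connectedSpace.1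
        ((convex_closedBall (0 : E2) 1).isConnected ⟨0, by simp⟩)
    exact isConnected_iff_connectedSpace.2
      (φ.symm.surjective.connectedSpace φ.symm.continuous)
  · have hsub : (zTurn n (i : ℕ) ⁻¹' (zRot α ⁻¹' drilledWedge τ μ)) ⊆
        zTurn n (i : ℕ) ⁻¹' torusTile τ μ α := fun x hx => Or.inl hx
    refine Nonempty.mono (interior_mono hsub) ?_
    have hpre (f : E3 ≃ᵢ E3) {s : Set E3} (hs : (interior s).Nonempty) :
        (interior (f ⁻¹' s)).Nonempty := by
      have := f.toHomeomorph.preimage_interior s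
      change f ⁻¹' interior s = interior (f ⁻¹' s) at this
      rw [← this]
      exact hs.preimage f.surjective
    exact hpre _ (hpre _ (interior_drilledWedge_nonempty τ hμ))
  · by_contra hne
    have hdvd := dvd_of_interior_inter_nonempty (by omega) hμ (nonempty_iff_ne_empty.2 hne)
    obtain ⟨q, hq⟩ := hdvd
    have hi := i.2
    have hj := j.2
    apply hij
    ext
    have : q = 0 := by
      by_contra hq0
      obtain h | h := lt_or_gt_of_ne hq0
      · nlinarith
      · nlinarith
    subst this
    omega
  · refine ⟨(zTurn n (i : ℕ)).trans (zTurn n (j : ℕ)).symm, ?_⟩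
    change (fun x => (zTurn n (j : ℕ)).symm (zTurn n (i : ℕ) x)) '' _ = _
    rw [← image_image, image_preimage_eq _ (zTurn n (i : ℕ)).surjective]
    exact (zTurn n (j : ℕ)).toEquiv.image_symm_eq_preimage _
end
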